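/- Let A be a simple, non-elementary C*-algebra such that Cu(A) has covering dimension zero and is weakly cancellative. Then there exists n ∈ ℕ such that wdiv₂(x) ≤ n for every x ∈ Cu(A). -/

import Mathlib

/-!
Common definitions: abstract Cuntz semigroups, divisibility, and C*-algebra notions
(nowhere scatteredness, σ-unitality, etc.) used to formalize the statements.
-/

open scoped MultiplierAlgebra ENNReal
open Filter Topology

noncomputable section

universe uu vv

/-- The (sequential) way-below relation `x ≪ y` (compact containment) in a partially
ordered set: whenever an increasing sequence has a supremum lying above `y`, some term
of the sequence already lies above `x`. -/
def WayBelow {S : Type*} [PartialOrder S] (x y : S) : Prop :=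
  ∀ f : ℕ → S, Monotone f → ∀ s : S, IsLUB (Set.range f) s → y ≤ s → ∃ n, x ≤ f n

/-- An abstract Cuntz semigroup (`Cu`-semigroup): a positively ordered abelian monoid in
which every increasing sequence has a supremum, every element is the supremum of a
`≪`-increasing sequence, addition preserves `≪`, and which satisfies the standard
axioms (O5) (almost algebraic order) and (O6) (almost Riesz decomposition), as well as
the existence of infima with idempotents `∞y = sup_n n•y` (all of these hold in the
Cuntz semigroup of any C*-algebra). -/
class CuSemigroup (S : Type*) extends AddCommMonoid S, PartialOrder S where
  add_le_add' : ∀ a b : S, a ≤ b → ∀ c : S, c + a ≤ c + b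
  zero_le' : ∀ x : S, 0 ≤ x
  exists_isLUB : ∀ f : ℕ → S, Monotone f → ∃ s : S, IsLUB (Set.range f) s
  exists_waybelow_seq : ∀ x : S, ∃ f : ℕ → S, Monotone f ∧
    (∀ n, WayBelow (f n) (f (n + 1))) ∧ IsLUB (Set.range f) x
  waybelow_add : ∀ {x y z w : S}, WayBelow x y → WayBelow z w → WayBelow (x + z) (y + w)
  /-- axiom (O5) -/
  almost_algebraic : ∀ x' x y' y z : S, WayBelow x' x → WayBelow y' y → x + y ≤ z →
    ∃ c : S, y' ≤ c ∧ x' + c ≤ z ∧ z ≤ x + c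
  /-- axiom (O6) -/
  almost_riesz : ∀ x' x y z : S, WayBelow x' x → x ≤ y + z →
    ∃ v w : S, v ≤ x ∧ v ≤ y ∧ w ≤ x ∧ w ≤ z ∧ x' ≤ v + w
  /-- `infty y = ∞·y = sup_n n•y` -/
  infty : S → S
  isLUB_infty : ∀ y : S, IsLUB (Set.range fun n : ℕ => n • y) (infty y)
  /-- the infimum `x ⊓ ∞y`, which exists in the Cuntz semigroup of any C*-algebra -/
  meetInfty : S → S → S
  isGLB_meetInfty : ∀ x y : S, IsGLB {x, infty y} (meetInfty x y)

namespace CuDiv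

variable {S : Type*} [CuSemigroup S]

/-- `x` is weakly `(m, n)`-divisible. -/
def IsWeaklyDivisible (m n : ℕ) (x : S) : Prop :=
  ∀ x' : S, WayBelow x' x → ∃ y : Fin n → S, x' ≤ ∑ j, y j ∧ ∀ j, m • y j ≤ x

/-- `x` is `(m, n)`-divisible. -/
def IsDivisible (m n : ℕ) (x : S) : Prop :=
  ∀ x' : S, WayBelow x' x → ∃ y : S, x' ≤ n • y ∧ m • y ≤ x

/-- `x` is weakly `(m, ω)`-divisible. -/
def IsWeaklyOmegaDivisible (m : ℕ) (x : S) : Prop :=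
  ∀ x' : S, WayBelow x' x → ∃ (n : ℕ) (y : Fin n → S), x' ≤ ∑ j, y j ∧ ∀ j, m • y j ≤ x

/-- `x` is `(m, ω)`-divisible. -/
def IsOmegaDivisible (m : ℕ) (x : S) : Prop :=
  ∀ x' : S, WayBelow x' x → ∃ (y : S) (n : ℕ), x' ≤ n • y ∧ m • y ≤ x

/-- `wdiv m x` is the least positive integer `n` such that `x` is weakly
`(m,n)`-divisible, and `∞` if there is no such `n`. -/
def wdiv (m : ℕ) (x : S) : ℕ∞ :=
  sInf {N : ℕ∞ | ∃ n : ℕ, 1 ≤ n ∧ N = n ∧ IsWeaklyDivisible m n x}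

/-- `Div m x` is the least positive integer `n` such that `x` is `(m,n)`-divisible,
and `∞` if there is no such `n`. -/
def Div (m : ℕ) (x : S) : ℕ∞ :=
  sInf {N : ℕ∞ | ∃ n : ℕ, 1 ≤ n ∧ N = n ∧ IsDivisible m n x}

/-- An element `x` is strongly soft if for every `x' ≪ x` there is `t` with
`x' + t ≤ x ≤ ∞t`. -/
def StronglySoft (x : S) : Prop :=
  ∀ x' : S, WayBelow x' x → ∃ t : S, x' + t ≤ x ∧ x ≤ CuSemigroup.infty t

/-- The Cuntz semigroup characterization of the Global Glimm Property: every element is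
`(m, ω)`-divisible for every `m`. -/
def GlobalGlimm (S : Type*) [CuSemigroup S] : Prop :=
  ∀ (m : ℕ) (x : S), IsOmegaDivisible m x

/-- `Cu(A)` is left-soft separative. -/
def LeftSoftSeparative (S : Type*) [CuSemigroup S] : Prop :=
  ∀ x y t : S, StronglySoft x → WayBelow (x + t) (y + t) →
    WayBelow t (CuSemigroup.infty y) → WayBelow t (CuSemigroup.infty x) → WayBelow x y

/-- `Cu(A)` is weakly cancellative. -/
def WeaklyCancellative (S : Type*) [CuSemigroup S] : Prop :=
  ∀ x y z : S, WayBelow (x + z) (y + z) → WayBelow x y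

/-- `Cu(A)` has covering dimension zero. -/
def CoveringDimZero (S : Type*) [CuSemigroup S] : Prop :=
  ∀ x' x y₁ y₂ : S, WayBelow x' x → WayBelow x (y₁ + y₂) →
    ∃ z₁ z₂ : S, z₁ ≤ y₁ ∧ z₂ ≤ y₂ ∧ x' ≤ z₁ + z₂ ∧ z₁ + z₂ ≤ x

end CuDiv

/-- A functional on a Cuntz semigroup: an additive, order preserving map to `ℝ≥0∞`
preserving suprema of increasing sequences.  (By Elliott–Robert–Santiago, the
functionals on `Cu(A)` are exactly those induced by the lower semicontinuous
2-quasitraces on `A ⊗ K`.) -/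
structure CuFunctional (S : Type*) [CuSemigroup S] where
  toFun : S → ℝ≥0∞
  map_zero' : toFun 0 = 0
  map_add' : ∀ x y : S, toFun (x + y) = toFun x + toFun y
  mono' : ∀ x y : S, x ≤ y → toFun x ≤ toFun y
  sup' : ∀ f : ℕ → S, Monotone f → ∀ s : S, IsLUB (Set.range f) s →
    toFun s = ⨆ n, toFun (f n)

instance {S : Type*} [CuSemigroup S] : CoeFun (CuFunctional S) fun _ => S → ℝ≥0∞ :=
  ⟨CuFunctional.toFun⟩

namespace CuDiv

variable {S : Type*} [CuSemigroup S]

/-- `x <ₛ y` : there is `γ < 1` with `λ(x) ≤ γ·λ(y)` for every functional `λ`. -/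
def FunctionalLT (x y : S) : Prop :=
  ∃ γ : ℝ≥0∞, γ < 1 ∧ ∀ lam : CuFunctional S, lam x ≤ γ * lam y

/-- `A` has `k`-comparison (stated on `Cu(A)`). -/
def KComparison (S : Type*) [CuSemigroup S] (k : ℕ) : Prop :=
  ∀ (x : S) (b : Fin (k + 1) → S), (∀ i, FunctionalLT x (b i)) → x ≤ ∑ i, b i

/-- `A` has strict comparison (stated on `Cu(A)`, via functionals, which correspond to
the lower semicontinuous 2-quasitraces). -/
def StrictComparison (S : Type*) [CuSemigroup S] : Prop :=
  ∀ x y : S, FunctionalLT x y → x ≤ y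

/-- The natural topology on the cone `F(Cu(A))` of functionals. -/
def functionalTopology (S : Type*) [CuSemigroup S] : TopologicalSpace (CuFunctional S) :=
  TopologicalSpace.generateFrom
    ({U | ∃ (x : S) (r : ℝ≥0∞), U = {lam : CuFunctional S | r < lam x}} ∪
      {U | ∃ (x' x : S) (r : ℝ≥0∞), WayBelow x' x ∧ U = {lam : CuFunctional S | lam x' < r}})

/-- A lower semicontinuous affine function on the cone of functionals of `Cu(A)`,
i.e. an element of `L(F(Cu(A)))`. -/
def IsLscAffine (F : CuFunctional S → ℝ≥0∞) : Prop :=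
  (letI := functionalTopology S; LowerSemicontinuous F) ∧
    (∀ lam mu nu : CuFunctional S, (∀ x, nu x = lam x + mu x) → F nu = F lam + F mu) ∧
    (∀ (r : ℝ≥0∞) (lam nu : CuFunctional S), (∀ x, nu x = r * lam x) → F nu = r * F lam)

/-- The rank map of `Cu(A)` is surjective: every lower semicontinuous affine function on
the cone of functionals is realized as the rank function `λ ↦ λ(x)` of an element. -/
def SurjectiveRankMap (S : Type*) [CuSemigroup S] : Prop :=
  ∀ F : CuFunctional S → ℝ≥0∞, IsLscAffine F → ∃ y : S, ∀ lam : CuFunctional S, lam y = F lam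

end CuDiv

/-! ### C*-algebra notions -/

section CStar

variable {B : Type*} [NonUnitalCStarAlgebra B]

/-- Positivity in a C*-algebra: `a` is positive iff it is of the form `star b * b`. -/
def CStarNonneg (a : B) : Prop := ∃ b : B, a = star b * b

/-- Cuntz subequivalence `a ≼ b` : `a = lim_n rₙ b rₙ*`. -/
def CuntzBelow (a b : B) : Prop :=
  ∃ r : ℕ → B, Tendsto (fun n => r n * b * star (r n)) atTop (𝓝 a)

/-- Cuntz equivalence. -/
def CuntzEquiv (a b : B) : Prop := CuntzBelow a b ∧ CuntzBelow b a

/-- `A` is σ-unital: it has a countable (norm-bounded, positive) approximate unit. -/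
def SigmaUnital (A : Type*) [NonUnitalCStarAlgebra A] : Prop :=
  ∃ e : ℕ → A, (∀ n, CStarNonneg (e n) ∧ ‖e n‖ ≤ 1) ∧
    ∀ a : A, Tendsto (fun n => e n * a) atTop (𝓝 a) ∧ Tendsto (fun n => a * e n) atTop (𝓝 a)

end CStar

/-- A closed two-sided (automatically star-closed) ideal of a C*-algebra. -/
structure ClosedTwoSidedIdealC (A : Type*) [NonUnitalCStarAlgebra A] where
  carrier : NonUnitalStarSubalgebra ℂ A
  isClosed : IsClosed (carrier : Set A)
  mul_mem_left : ∀ a : A, ∀ x ∈ carrier, a * x ∈ carrier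
  mul_mem_right : ∀ a : A, ∀ x ∈ carrier, x * a ∈ carrier

section Reps

variable {A : Type*} [NonUnitalCStarAlgebra A]
variable {H : Type*} [NormedAddCommGroup H] [InnerProductSpace ℂ H] [CompleteSpace H]

/-- A (topologically) irreducible representation of `A` on a Hilbert space `H`. -/
def IsIrreducibleRep (π : A →⋆ₙₐ[ℂ] (H →L[ℂ] H)) : Prop :=
  (∃ a : A, π a ≠ 0) ∧
    ∀ K : Submodule ℂ H, IsClosed (K : Set H) → (∀ a : A, ∀ v ∈ K, π a v ∈ K) →
      K = ⊥ ∨ K = ⊤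

end Reps

/-- `A` has a nonzero elementary ideal-quotient `J/I`, expressed via a surjection of a
closed two-sided ideal `J` of `A` onto the algebra of compact operators on a Hilbert
space (the kernel `I` of such a `*`-homomorphism is automatically a closed two-sided
ideal of `A`, and conversely any nonzero elementary ideal-quotient arises this way). -/
def HasNonzeroElementaryIdealQuotient (A : Type*) [NonUnitalCStarAlgebra A] : Prop :=
  ∃ (J : ClosedTwoSidedIdealC A) (H : Type) (_ : NormedAddCommGroup H)
    (_ : InnerProductSpace ℂ H) (_ : CompleteSpace H)
    (ψ : J.carrier →⋆ₙₐ[ℂ] (H →L[ℂ] H)),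
      Set.range ψ = {T : H →L[ℂ] H | IsCompactOperator ⇑T} ∧ ∃ x, ψ x ≠ 0

/-- A C*-algebra is nowhere scattered if no ideal-quotient of it is nonzero and
elementary. -/
def NowhereScattered (A : Type*) [NonUnitalCStarAlgebra A] : Prop :=
  ¬ HasNonzeroElementaryIdealQuotient A

/-- A C*-algebra is elementary if it is isomorphic to the algebra of compact operators
on some Hilbert space. -/
def IsElementaryCStar (A : Type*) [NonUnitalCStarAlgebra A] : Prop :=
  ∃ (H : Type) (_ : NormedAddCommGroup H) (_ : InnerProductSpace ℂ H) (_ : CompleteSpace H)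
    (ψ : A →⋆ₙₐ[ℂ] (H →L[ℂ] H)),
      Function.Injective ψ ∧ Set.range ψ = {T : H →L[ℂ] H | IsCompactOperator ⇑T}

/-- A C*-algebra is simple if it is nonzero and has no nontrivial closed two-sided
ideals. -/
def IsSimpleCStar (A : Type*) [NonUnitalCStarAlgebra A] : Prop :=
  (∃ a : A, a ≠ 0) ∧
    ∀ J : ClosedTwoSidedIdealC A, (J.carrier : Set A) = {0} ∨ (J.carrier : Set A) = Set.univ

/-- Real rank zero: the invertible self-adjoint elements are dense in the self-adjoint
part of the minimal unitization. -/
def RealRankZero (A : Type*) [NonUnitalCStarAlgebra A] : Prop :=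
  ∀ x : Unitization ℂ A, IsSelfAdjoint x →
    x ∈ closure {y : Unitization ℂ A | IsSelfAdjoint y ∧ IsUnit y}

/-- Stable rank one: the invertible elements are dense in the minimal unitization. -/
def StableRankOne (A : Type*) [NonUnitalCStarAlgebra A] : Prop :=
  ∀ x : Unitization ℂ A, x ∈ closure {y : Unitization ℂ A | IsUnit y}

section CP

variable {A B : Type*} [NonUnitalCStarAlgebra A] [NonUnitalCStarAlgebra B]

/-- A linear map between C*-algebras is completely positive if all of its matrix
amplifications preserve positivity. -/
def IsCompletelyPositive (φ : A →ₗ[ℂ] B) : Prop :=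
  ∀ (n : ℕ) (a : Matrix (Fin n) (Fin n) A), (∃ b : Matrix (Fin n) (Fin n) A, a = star b * b) →
    ∃ c : Matrix (Fin n) (Fin n) B, a.map ⇑φ = star c * c

/-- A completely positive contractive (c.p.c.) map. -/
def IsCPC (φ : A →ₗ[ℂ] B) : Prop :=
  IsCompletelyPositive φ ∧ ∀ a : A, ‖φ a‖ ≤ ‖a‖

/-- A map between C*-algebras has order zero if it preserves orthogonality of positive
elements. -/
def IsOrderZero (φ : A →ₗ[ℂ] B) : Prop :=
  ∀ a b : A, CStarNonneg a → CStarNonneg b → a * b = 0 → φ a * φ b = 0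

end CP

/-- `A` has nuclear dimension at most `k`: there are c.p.c. approximations of the
identity through finite dimensional C*-algebras in which the downwards maps are sums of
`k+1` c.p.c. order zero maps. -/
def NuclearDimLE (A : Type*) [NonUnitalCStarAlgebra A] (k : ℕ) : Prop :=
  ∀ (F : Finset A) (ε : ℝ), 0 < ε →
    ∃ (Fd : Type) (_ : NonUnitalCStarAlgebra Fd) (_ : FiniteDimensional ℂ Fd)
      (ψ : A →ₗ[ℂ] Fd) (φ : Fin (k + 1) → (Fd →ₗ[ℂ] A)),
        IsCPC ψ ∧ (∀ i, IsCPC (φ i) ∧ IsOrderZero (φ i)) ∧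
        ∀ a ∈ F, ‖(∑ i, φ i (ψ a)) - a‖ ≤ ε

section Prim

variable (A : Type*) [NonUnitalCStarAlgebra A]

/-- A primitive ideal: the kernel of an irreducible representation. -/
def IsPrimitiveIdeal {A : Type*} [NonUnitalCStarAlgebra A] (J : ClosedTwoSidedIdealC A) : Prop :=
  ∃ (H : Type) (_ : NormedAddCommGroup H) (_ : InnerProductSpace ℂ H) (_ : CompleteSpace H)
    (π : A →⋆ₙₐ[ℂ] (H →L[ℂ] H)),
      IsIrreducibleRep π ∧ ∀ a : A, a ∈ J.carrier ↔ π a = 0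

/-- The primitive ideal space of `A`. -/
def PrimIdealSpace := {J : ClosedTwoSidedIdealC A // IsPrimitiveIdeal J}

/-- The hull-kernel (Jacobson) topology on the primitive ideal space. -/
instance : TopologicalSpace (PrimIdealSpace A) :=
  TopologicalSpace.generateFrom {U | ∃ a : A, U = {P : PrimIdealSpace A | a ∉ P.1.carrier}}

/-- `A` has topological dimension zero: the primitive ideal space has a basis of
compact open sets. -/
def TopDimZero : Prop :=
  ∃ 𝒷 : Set (Set (PrimIdealSpace A)), TopologicalSpace.IsTopologicalBasis 𝒷 ∧
    ∀ U ∈ 𝒷, IsCompact U ∧ IsOpen U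

end Prim

section Proj

variable {B : Type*} [NonUnitalCStarAlgebra B]

/-- A projection in a C*-algebra. -/
def IsProjectionElem (p : B) : Prop := IsSelfAdjoint p ∧ p * p = p

/-- `B` contains an infinite projection: a projection which is Murray-von Neumann
equivalent to a proper subprojection of itself. -/
def HasInfiniteProjection (B : Type*) [NonUnitalCStarAlgebra B] : Prop :=
  ∃ p v : B, IsProjectionElem p ∧ star v * v = p ∧
    p * (v * star v) = v * star v ∧ v * star v ≠ p

end Proj

/-! ### The Cuntz semigroup of a C*-algebra -/

/-- Padding a matrix by one extra row and column of zeros. -/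
def matPad {A : Type*} [Zero A] {n : ℕ} (a : Matrix (Fin n) (Fin n) A) :
    Matrix (Fin (n + 1)) (Fin (n + 1)) A :=
  Matrix.of fun i j =>
    if h : (i : ℕ) < n ∧ (j : ℕ) < n then a ⟨i, h.1⟩ ⟨j, h.2⟩ else 0

/-- A witness that `S` is the Cuntz semigroup of the C*-algebra `A`: it provides a
stabilization `stab` of `A` (a model of `A ⊗ K`, described as the C*-completion of the
union of the matrix algebras `Mₙ(A)`), together with the class map
`cls : (stab)₊ → S = Cu(A)` identifying `S` with the set of Cuntz equivalence classes of
positive elements of `A ⊗ K`, with order induced by Cuntz subequivalence, addition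
induced by orthogonal (diagonal) addition, and with the compact containment relation
`≪` given by `x ≪ [a]` iff `x ≤ [(a - ε)₊]` for some `ε > 0`. -/
structure IsCuntzSemigroupOf (A : Type uu) [NonUnitalCStarAlgebra A]
    (S : Type vv) [CuSemigroup S] where
  stab : Type (max uu vv)
  [stabCStar : NonUnitalCStarAlgebra stab]
  matEmb : (n : ℕ) → (Matrix (Fin n) (Fin n) A →⋆ₙₐ[ℂ] stab)
  matEmb_injective : ∀ n, Function.Injective (matEmb n)
  matEmb_compat : ∀ (n : ℕ) (a : Matrix (Fin n) (Fin n) A), matEmb (n + 1) (matPad a) = matEmb n a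
  matEmb_dense : Dense (⋃ n, Set.range (matEmb n))
  cls : stab → S
  cls_zero : cls 0 = 0
  cls_surj : ∀ s : S, ∃ b : stab, CStarNonneg b ∧ cls b = s
  cls_le_iff : ∀ a b : stab, CStarNonneg a → CStarNonneg b → (cls a ≤ cls b ↔ CuntzBelow a b)
  cls_add_orth : ∀ a b : stab, CStarNonneg a → CStarNonneg b → a * b = 0 →
    cls (a + b) = cls a + cls b
  exists_orth : ∀ a b : stab, CStarNonneg a → CStarNonneg b →
    ∃ a' b' : stab, CStarNonneg a' ∧ CStarNonneg b' ∧ a' * b' = 0 ∧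
      cls a' = cls a ∧ cls b' = cls b
  waybelow_iff : ∀ (x : S) (a : stab), CStarNonneg a →
    (WayBelow x (cls a) ↔ ∃ ε : ℝ, 0 < ε ∧ x ≤ cls (cfcₙ (fun t : ℝ => max (t - ε) 0) a))

attribute [instance] IsCuntzSemigroupOf.stabCStar

/-- The Cuntz class `[a] ∈ Cu(A)` of an element `a` of `A` itself (via the canonical
embedding `A ≅ M₁(A) ⊆ A ⊗ K`). -/
def IsCuntzSemigroupOf.clsA {A : Type*} [NonUnitalCStarAlgebra A] {S : Type*} [CuSemigroup S]
    (h : IsCuntzSemigroupOf A S) (a : A) : S :=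
  h.cls (h.matEmb 1 (Matrix.of fun _ _ => a))

/-- `B` has a surjective rank map (every lower semicontinuous affine function on the
cone of functionals on `Cu(B)` is realized as a rank function). -/
def HasSurjectiveRankMap (B : Type*) [NonUnitalCStarAlgebra B] : Prop :=
  ∀ (S : Type) (inst : CuSemigroup S), IsCuntzSemigroupOf B S → CuDiv.SurjectiveRankMap S

/-- The family of separable sub-C*-algebras of `A` having a surjective rank map. -/
def sepSurjRankFamily (A : Type*) [NonUnitalCStarAlgebra A] :
    Set (NonUnitalStarSubalgebra ℂ A) :=
  {B | ∃ _h : IsClosed (B : Set A),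
    TopologicalSpace.SeparableSpace B ∧ HasSurjectiveRankMap B}

/-- The family of separable sub-C*-algebras of `A` with a surjective rank map is
σ-complete (closed under countable increasing unions) and cofinal (every separable
sub-C*-algebra is contained in a member). -/
def SepSurjRankFamilySigmaCompleteCofinal (A : Type*) [NonUnitalCStarAlgebra A] : Prop :=
  (∀ Bseq : ℕ → NonUnitalStarSubalgebra ℂ A, Monotone Bseq →
    (∀ n, Bseq n ∈ sepSurjRankFamily A) →
      (⨆ n, Bseq n).topologicalClosure ∈ sepSurjRankFamily A) ∧
  (∀ C : NonUnitalStarSubalgebra ℂ A, IsClosed (C : Set A) →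
    TopologicalSpace.SeparableSpace C → ∃ B ∈ sepSurjRankFamily A, C ≤ B)

end

/-! ### Order-theoretic part -/

namespace CuDiv

variable {S : Type*} [CuSemigroup S]

instance instIsOrderedAddMonoid : IsOrderedAddMonoid S where
  add_le_add_left a b h c := by
    rw [add_comm a c, add_comm b c]
    exact CuSemigroup.add_le_add' a b h c

/-- Suprema are compatible with addition: whatever is compactly contained in a sum is
dominated by a sum of elements compactly contained in the summands. -/
def SplitsWayBelow (S : Type*) [CuSemigroup S] : Prop :=
  ∀ g x y : S, WayBelow g (x + y) → ∃ v w : S, WayBelow v x ∧ WayBelow w y ∧ g ≤ v + w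

/-- Every nonzero element is full. -/
def EveryNonzeroFull (S : Type*) [CuSemigroup S] : Prop :=
  ∀ x y : S, y ≠ 0 → x ≤ CuSemigroup.infty y

/-- Every nonzero element dominates the double of a nonzero element. -/
def Atomless (S : Type*) [CuSemigroup S] : Prop :=
  ∀ y : S, y ≠ 0 → ∃ d : S, d ≠ 0 ∧ d + d ≤ y

lemma eq_zero_of_le_zero {x : S} (h : x ≤ 0) : x = 0 :=
  le_antisymm h (CuSemigroup.zero_le' x)

lemma ne_zero_of_le {x y : S} (hx : x ≠ 0) (h : x ≤ y) : y ≠ 0 := by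
  rintro rfl
  exact hx (eq_zero_of_le_zero h)

lemma le_add_of_le_left {x y : S} (z : S) (h : x ≤ y) : x ≤ y + z := by
  simpa using add_le_add h (CuSemigroup.zero_le' z)

lemma le_add_of_le_right {x y : S} (z : S) (h : x ≤ y) : x ≤ z + y := by
  simpa using add_le_add (CuSemigroup.zero_le' z) h

lemma _root_.WayBelow.le {x y : S} (h : WayBelow x y) : x ≤ y := by
  obtain ⟨_, hn⟩ := h (fun _ => y) monotone_const y (by simp) le_rfl
  exact hn

lemma _root_.WayBelow.trans_le {x y z : S} (h : WayBelow x y) (hyz : y ≤ z) : WayBelow x z :=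
  fun f hf s hs hzs => h f hf s hs (hyz.trans hzs)

lemma _root_.LE.le.trans_wayBelow {x y z : S} (hxy : x ≤ y) (h : WayBelow y z) :
    WayBelow x z := fun f hf s hs hzs => by
  obtain ⟨n, hn⟩ := h f hf s hs hzs
  exact ⟨n, hxy.trans hn⟩

lemma zero_wayBelow (x : S) : WayBelow 0 x :=
  fun f _ _ _ _ => ⟨0, CuSemigroup.zero_le' (f 0)⟩

lemma _root_.WayBelow.interpolate {x z : S} (h : WayBelow x z) :
    ∃ y, WayBelow x y ∧ WayBelow y z := by
  obtain ⟨f, hf, hff, hs⟩ := CuSemigroup.exists_waybelow_seq z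
  obtain ⟨n, hn⟩ := h f hf z hs le_rfl
  exact ⟨f (n + 1), hn.trans_wayBelow (hff n),
    (hff (n + 1)).trans_le (hs.1 (Set.mem_range_self _))⟩

lemma le_of_forall_wayBelow {x y : S} (h : ∀ x', WayBelow x' x → x' ≤ y) : x ≤ y := by
  obtain ⟨f, _, hff, hs⟩ := CuSemigroup.exists_waybelow_seq x
  refine hs.2 ?_
  rintro _ ⟨n, rfl⟩
  exact h _ ((hff n).trans_le (hs.1 (Set.mem_range_self _)))

lemma exists_wayBelow_ne_zero {x : S} (hx : x ≠ 0) : ∃ x', x' ≠ 0 ∧ WayBelow x' x := by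
  by_contra! h
  refine hx (eq_zero_of_le_zero (le_of_forall_wayBelow fun x' hx' => ?_))
  by_contra h'
  exact h x' (fun h0 => h' h0.le) hx'

lemma sum_wayBelow {f g : ℕ → S} (h : ∀ i, WayBelow (f i) (g i)) (n : ℕ) :
    WayBelow (∑ i ∈ Finset.range n, f i) (∑ i ∈ Finset.range n, g i) := by
  induction n with
  | zero => simpa using zero_wayBelow (0 : S)
  | succ n ih =>
    rw [Finset.sum_range_succ, Finset.sum_range_succ]
    exact CuSemigroup.waybelow_add ih (h n)

/-- An element compactly contained in another one is dominated by a multiple of any given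
nonzero element. -/
lemma exists_le_nsmul (hfull : EveryNonzeroFull S) {x' x y : S} (hx : WayBelow x' x)
    (hy : y ≠ 0) : ∃ n : ℕ, x' ≤ n • y := by
  refine hx (fun n : ℕ => n • y) (fun m n hmn => ?_) _ (CuSemigroup.isLUB_infty y) (hfull x y hy)
  exact nsmul_le_nsmul_left (CuSemigroup.zero_le' y) hmn

lemma exists_common_lower_bound_of_le_nsmul {d : S} (n : ℕ) :
    ∀ c : S, c ≠ 0 → c ≤ n • d → ∃ b, b ≠ 0 ∧ b ≤ c ∧ b ≤ d := by
  induction n with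
  | zero =>
    intro c hc hcd
    exact absurd (eq_zero_of_le_zero (by simpa using hcd)) hc
  | succ n ih =>
    intro c hc hcd
    obtain ⟨c', hc', hcc⟩ := exists_wayBelow_ne_zero hc
    rw [succ_nsmul] at hcd
    obtain ⟨v, w, hvc, hvd, hwc, hwd, hle⟩ := CuSemigroup.almost_riesz c' c _ _ hcc hcd
    by_cases hw : w = 0
    · subst hw
      rw [add_zero] at hle
      obtain ⟨b, hb, hbv, hbd⟩ := ih v (ne_zero_of_le hc' hle) hvd
      exact ⟨b, hb, hbv.trans hvc, hbd⟩
    · exact ⟨w, hw, hwc, hwd⟩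

lemma exists_common_lower_bound (hfull : EveryNonzeroFull S) {c d : S} (hc : c ≠ 0)
    (hd : d ≠ 0) : ∃ b, b ≠ 0 ∧ b ≤ c ∧ b ≤ d := by
  obtain ⟨c', hc', hcc⟩ := exists_wayBelow_ne_zero hc
  obtain ⟨n, hn⟩ := exists_le_nsmul hfull hcc hd
  obtain ⟨b, hb, hbc, hbd⟩ := exists_common_lower_bound_of_le_nsmul n c' hc' hn
  exact ⟨b, hb, hbc.trans hcc.le, hbd⟩

lemma exists_ne_zero_nsmul_le (hat : Atomless S) {y : S} (hy : y ≠ 0) (n : ℕ) :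
    ∃ d, d ≠ 0 ∧ n • d ≤ y := by
  have key : ∃ d : S, d ≠ 0 ∧ 2 ^ n • d ≤ y := by
    induction n with
    | zero => exact ⟨y, hy, by simp⟩
    | succ n ih =>
      obtain ⟨d, hd, hdy⟩ := ih
      obtain ⟨b, hb, hbd⟩ := hat d hd
      refine ⟨b, hb, le_trans ?_ hdy⟩
      rw [pow_succ, mul_smul, two_nsmul]
      exact nsmul_le_nsmul_right hbd _
  obtain ⟨d, hd, hdy⟩ := key
  exact ⟨d, hd, (nsmul_le_nsmul_left (CuSemigroup.zero_le' d) Nat.lt_two_pow_self.le).trans hdy⟩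

/-- There are arbitrarily large elements with an arbitrarily small gap to an element
compactly contained in them. -/
lemma exists_large_small_gap (hfull : EveryNonzeroFull S) {x' x d : S} (hx : WayBelow x' x)
    (hd : d ≠ 0) :
    ∃ e₀ e g : S, WayBelow e₀ e ∧ WayBelow g d ∧ x' ≤ e ∧ e ≤ e₀ + g := by
  obtain ⟨f, hf, hff, hs⟩ := CuSemigroup.exists_waybelow_seq d
  have hfd : ∀ n, WayBelow (f n) d := fun n =>
    (hff n).trans_le (hs.1 (Set.mem_range_self _))
  obtain ⟨k, hk⟩ : ∃ k, f k ≠ 0 := by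
    by_contra! h
    refine hd (eq_zero_of_le_zero (hs.2 ?_))
    rintro _ ⟨n, rfl⟩
    exact (h n).le
  obtain ⟨M, hM⟩ := exists_le_nsmul hfull hx hk
  refine ⟨∑ i ∈ Finset.range M, f (k + i), ∑ i ∈ Finset.range M, f (k + (i + 1)), f (k + M),
    sum_wayBelow (fun i => hff (k + i)) M, hfd _, hM.trans ?_, ?_⟩
  · simpa using Finset.card_nsmul_le_sum (Finset.range M) (fun i => f (k + (i + 1))) (f k)
      (fun i _ => hf (by omega))
  · rw [← Finset.sum_range_succ (fun i => f (k + i)) M, Finset.sum_range_succ']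
    exact le_add_of_le_left _ le_rfl

/-- Every compact containment interpolates a second one with an arbitrarily small gap. -/
lemma exists_interpolation_small_gap (hsplit : SplitsWayBelow S) (hfull : EveryNonzeroFull S)
    (hdim0 : CoveringDimZero S) (hwc : WeaklyCancellative S) {x' x d : S} (hx : WayBelow x' x)
    (hd : d ≠ 0) :
    ∃ z' z : S, x' ≤ z' ∧ WayBelow z' z ∧ z ≤ x ∧ z ≤ z' + d := by
  by_cases hcpt : ∃ k : S, x' ≤ k ∧ k ≤ x ∧ WayBelow k k
  · obtain ⟨k, hk₁, hk₂, hk⟩ := hcpt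
    exact ⟨k, k, hk₁, hk, hk₂, le_add_of_le_left _ le_rfl⟩
  push Not at hcpt
  obtain ⟨x₂, hx₂, hx₂x⟩ := hx.interpolate
  obtain ⟨x₁, hx₁, hx₁₂⟩ := hx₂.interpolate
  obtain ⟨x₃, hx₂₃, hx₃x⟩ := hx₂x.interpolate
  obtain ⟨x₄, hx₃₄, hx₄x⟩ := hx₃x.interpolate
  -- the gap between `x₁` and `x₃` contains a nonzero element `b ≤ d`
  obtain ⟨c, -, hc₁, hc₂⟩ := CuSemigroup.almost_algebraic x₁ x₂ 0 0 x₃ hx₁₂ (zero_wayBelow 0)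
    (by simpa using hx₂₃.le)
  have hc : c ≠ 0 := by
    rintro rfl
    rw [add_zero] at hc₂
    exact hcpt x₃ (hx₂.le.trans hx₂₃.le) hx₃x.le (hc₂.trans_wayBelow hx₂₃)
  obtain ⟨b, hb, hbc, hbd⟩ := exists_common_lower_bound hfull hc hd
  obtain ⟨e₀, e, g, he₀, hg, hxe, heg⟩ := exists_large_small_gap hfull hx₄x hb
  obtain ⟨c₂, -, hc₃, hc₄⟩ := CuSemigroup.almost_algebraic x₃ x₄ 0 0 e hx₃₄ (zero_wayBelow 0)
    (by simpa using hxe)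
  obtain ⟨e₁, he₀₁, he₁⟩ := he₀.interpolate
  obtain ⟨e₂, he₁₂, he₂⟩ := he₁.interpolate
  obtain ⟨e₃, he₂₃, he₃⟩ := he₂.interpolate
  obtain ⟨z₁, z₂, hz₁, hz₂, hez, hze⟩ := hdim0 e₂ e₃ x₄ c₂ he₂₃ (he₃.trans_le hc₄)
  obtain ⟨z₁', z₂', hz₁', hz₂', hez'⟩ := hsplit e₁ z₁ z₂ (he₁₂.trans_le hez)
  have hgap : WayBelow e (z₁' + z₂' + b) :=
    (heg.trans_wayBelow (CuSemigroup.waybelow_add he₀₁ hg)).trans_le (by gcongr)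
  refine ⟨z₁', z₁, hx₁.le.trans (hwc x₁ z₁' (b + c₂) ?_).le, hz₁', hz₁.trans hx₄x.le,
    (hwc z₁ (z₁' + b) z₂ ?_).le.trans (by gcongr)⟩
  · have h₁ : x₁ + (b + c₂) ≤ e := by
      rw [← add_assoc]
      exact le_trans (by gcongr) ((add_le_add_left hc₁ c₂).trans hc₃)
    refine (h₁.trans_wayBelow hgap).trans_le ?_
    calc z₁' + z₂' + b ≤ z₁' + c₂ + b := by gcongr; exact hz₂'.le.trans hz₂
      _ = z₁' + (b + c₂) := by abel
  · refine ((hze.trans he₃.le).trans_wayBelow hgap).trans_le ?_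
    calc z₁' + z₂' + b ≤ z₁' + z₂ + b := by gcongr; exact hz₂'.le
      _ = z₁' + b + z₂ := by abel

/-- Two elements below `y` add up, up to a small gap, to a double plus an element below `y`. -/
lemma exists_double_add_of_pair (hsplit : SplitsWayBelow S) (hfull : EveryNonzeroFull S)
    (hdim0 : CoveringDimZero S) (hwc : WeaklyCancellative S) {a' a b' b y d : S}
    (ha : WayBelow a' a) (hay : a ≤ y) (hb : WayBelow b' b) (hby : b ≤ y) (hd : d ≠ 0) :
    ∃ v w : S, v + v + w ≤ a + b ∧ a' + b' ≤ v + v + w + d ∧ w ≤ y := by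
  obtain ⟨a₁, ha₁, ha₁a⟩ := ha.interpolate
  obtain ⟨b₁, hb₁, hb₁b⟩ := hb.interpolate
  obtain ⟨b₂, hb₂, hb₂b⟩ := hb₁b.interpolate
  obtain ⟨c, -, hc₁, hc₂⟩ := CuSemigroup.almost_algebraic a₁ a 0 0 y ha₁a (zero_wayBelow 0)
    (by simpa using hay)
  obtain ⟨p, q, hpa, hqc, hbpq, hpqb⟩ := hdim0 b₁ b₂ a c hb₂
    (hb₂b.trans_le (hby.trans hc₂))
  obtain ⟨p₀, q₀, hp₀, hq₀, hb₀⟩ := hsplit b' p q (hb₁.trans_le hbpq)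
  obtain ⟨p', p'', hp₀', hp', hp'', hgap⟩ :=
    exists_interpolation_small_gap hsplit hfull hdim0 hwc hp₀ hd
  obtain ⟨r, -, hr₁, hr₂⟩ := CuSemigroup.almost_algebraic p' p'' 0 0 a hp' (zero_wayBelow 0)
    (by simpa using hp''.trans hpa)
  obtain ⟨p₁, r₁, hp₁, hr, har, hra⟩ := hdim0 a' a₁ p'' r ha₁ (ha₁a.trans_le hr₂)
  refine ⟨p', r₁ + q, ?_, ?_, ?_⟩
  · calc p' + p' + (r₁ + q) ≤ p' + p + (r + q) := by gcongr; exact hp'.le.trans hp''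
      _ = (p' + r) + (p + q) := by abel
      _ ≤ a + b := by gcongr; exact hpqb.trans hb₂b.le
  · calc a' + b' ≤ (p₁ + r₁) + (p₀ + q₀) := by gcongr
      _ ≤ ((p' + d) + r₁) + (p' + q) := by
        gcongr
        · exact hp₁.trans hgap
        · exact hq₀.le
      _ = p' + p' + (r₁ + q) + d := by abel
  · have hr₁a : r₁ ≤ a₁ := (le_add_of_le_right _ le_rfl).trans hra
    calc r₁ + q ≤ a₁ + c := by gcongr
      _ ≤ y := hc₁

lemma exists_double_add_of_le_nsmul (hsplit : SplitsWayBelow S) (hfull : EveryNonzeroFull S)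
    (hdim0 : CoveringDimZero S) (hwc : WeaklyCancellative S) {y d : S} (hd : d ≠ 0) (n : ℕ) :
    ∀ x' x : S, WayBelow x' x → x ≤ n • y →
      ∃ u w : S, u + u + w ≤ x ∧ x' ≤ u + u + w + n • d ∧ w ≤ y := by
  induction n with
  | zero =>
    intro x' x hx hxy
    have hx0 : x = 0 := eq_zero_of_le_zero (by simpa using hxy)
    subst hx0
    exact ⟨0, 0, by simp, by simpa using hx.le, CuSemigroup.zero_le' y⟩
  | succ n ih =>
    intro x' x hx hxy
    rw [succ_nsmul] at hxy
    obtain ⟨x₁, hx₁, hx₁x⟩ := hx.interpolate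
    obtain ⟨x₂, hx₂, hx₂x⟩ := hx₁x.interpolate
    obtain ⟨x₃, hx₃, hx₃x⟩ := hx₂x.interpolate
    obtain ⟨a, b, ha, hb, hxab, habx⟩ := hdim0 x₂ x₃ _ _ hx₃ (hx₃x.trans_le hxy)
    obtain ⟨a', b', ha', hb', hxab'⟩ := hsplit x₁ a b (hx₂.trans_le hxab)
    obtain ⟨u, w, huw, hauw, hwy⟩ := ih a' a ha' ha
    have h₁ : x₁ ≤ w + (u + u + n • d + b') :=
      calc x₁ ≤ (u + u + w + n • d) + b' := hxab'.trans (by gcongr)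
        _ = w + (u + u + n • d + b') := by abel
    obtain ⟨w', t, hw', ht, hxw⟩ := hsplit x' w _ (hx₁.trans_le h₁)
    obtain ⟨v, w₁, hvw, hwb, hw₁⟩ := exists_double_add_of_pair hsplit hfull hdim0 hwc hw' hwy
      hb' hb hd
    refine ⟨u + v, w₁, ?_, ?_, hw₁⟩
    · calc u + v + (u + v) + w₁ = u + u + (v + v + w₁) := by abel
        _ ≤ u + u + (w + b) := by gcongr
        _ = u + u + w + b := by abel
        _ ≤ a + b := by gcongr
        _ ≤ x := habx.trans hx₃x.le
    · calc x' ≤ w' + (u + u + n • d + b') := hxw.trans (by gcongr; exact ht.le)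
        _ = (w' + b') + (u + u + n • d) := by abel
        _ ≤ (v + v + w₁ + d) + (u + u + n • d) := by gcongr
        _ = u + v + (u + v) + w₁ + (n + 1) • d := by rw [succ_nsmul]; abel

lemma isWeaklyDivisible_two_four (hsplit : SplitsWayBelow S) (hfull : EveryNonzeroFull S)
    (hat : Atomless S) (hdim0 : CoveringDimZero S) (hwc : WeaklyCancellative S) (x : S) :
    IsWeaklyDivisible 2 4 x := by
  intro x' hx
  by_cases hx0 : x = 0
  · subst hx0
    exact ⟨fun _ => 0, by simpa using hx.le, by simp⟩
  obtain ⟨y, hy, hyx⟩ := hat x hx0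
  obtain ⟨x₁, hx₁, hx₁x⟩ := hx.interpolate
  obtain ⟨n, hn⟩ := exists_le_nsmul hfull hx₁x hy
  obtain ⟨d, hd, hdy⟩ := exists_ne_zero_nsmul_le hat hy n
  obtain ⟨u, w, huw, hle, hwy⟩ := exists_double_add_of_le_nsmul hsplit hfull hdim0 hwc hd n
    x' x₁ hx₁ hn
  refine ⟨![u, u, y, y], ?_, ?_⟩
  · rw [Fin.sum_univ_four]
    exact hle.trans (add_le_add (add_le_add le_rfl hwy) hdy)
  · have hu : 2 • u ≤ x := by
      rw [two_nsmul]
      exact (le_add_of_le_left w le_rfl).trans (huw.trans hx₁x.le)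
    have hy : 2 • y ≤ x := by rwa [two_nsmul]
    intro j
    fin_cases j <;> assumption

lemma wdiv_le_of_isWeaklyDivisible {m n : ℕ} (hn : 1 ≤ n) {x : S}
    (h : IsWeaklyDivisible m n x) : wdiv m x ≤ n :=
  sInf_le ⟨n, hn, rfl, h⟩

end CuDiv

/-! ### Cuntz comparison in C*-algebras -/

section CuntzComparison

variable {B : Type*} [NonUnitalCStarAlgebra B]

lemma CStarNonneg.isSelfAdjoint {a : B} (ha : CStarNonneg a) : IsSelfAdjoint a := by
  obtain ⟨b, rfl⟩ := ha
  exact IsSelfAdjoint.star_mul_self b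

lemma CStarNonneg.quasispectrum_nonneg {a : B} (ha : CStarNonneg a) :
    ∀ s ∈ quasispectrum ℝ a, 0 ≤ s := by
  let _ := CStarAlgebra.spectralOrder B
  have _ := CStarAlgebra.spectralOrderedRing B
  obtain ⟨b, rfl⟩ := ha
  exact quasispectrum_nonneg_of_nonneg _ (star_mul_self_nonneg b)

lemma cStarNonneg_zero : CStarNonneg (0 : B) := ⟨0, by simp⟩

lemma cStarNonneg_cfcₙ {a : B} {f : ℝ → ℝ} (hf : Continuous f) (hf0 : f 0 = 0)
    (hpos : ∀ s, 0 ≤ f s) : CStarNonneg (cfcₙ f a) := by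
  have hsa : IsSelfAdjoint (cfcₙ (fun s => √(f s)) a) := cfcₙ_predicate _ a
  refine ⟨cfcₙ (fun s => √(f s)) a, ?_⟩
  rw [hsa.star_eq, ← cfcₙ_mul _ _ a (by fun_prop) (by simp [hf0]) (by fun_prop) (by simp [hf0])]
  exact cfcₙ_congr fun s _ => (Real.mul_self_sqrt (hpos s)).symm

lemma CStarNonneg.exists_sqrt {a : B} (ha : CStarNonneg a) :
    ∃ f : B, IsSelfAdjoint f ∧ a = f * f := by
  refine ⟨cfcₙ (fun s => √s) a, cfcₙ_predicate _ a, ?_⟩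
  have hsa := ha.isSelfAdjoint
  rw [← cfcₙ_mul _ _ a (by fun_prop) (by simp) (by fun_prop) (by simp)]
  conv_lhs => rw [← cfcₙ_id' ℝ a]
  exact cfcₙ_congr fun s hs => (Real.mul_self_sqrt (ha.quasispectrum_nonneg s hs)).symm

lemma CStarNonneg.add {a b : B} (ha : CStarNonneg a) (hb : CStarNonneg b) :
    CStarNonneg (a + b) := by
  let _ := CStarAlgebra.spectralOrder B
  have _ := CStarAlgebra.spectralOrderedRing B
  obtain ⟨x, rfl⟩ := ha
  obtain ⟨y, rfl⟩ := hb
  have hnn := add_nonneg (star_mul_self_nonneg x) (star_mul_self_nonneg y)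
  set c := star x * x + star y * y
  have hsa : IsSelfAdjoint c := .of_nonneg hnn
  have hsq : IsSelfAdjoint (cfcₙ (fun s : ℝ => √s) c) := cfcₙ_predicate _ c
  refine ⟨cfcₙ (fun s : ℝ => √s) c, ?_⟩
  rw [hsq.star_eq, ← cfcₙ_mul _ _ c (by fun_prop) (by simp) (by fun_prop) (by simp)]
  conv_lhs => rw [← cfcₙ_id' ℝ c]
  exact cfcₙ_congr fun s hs =>
    (Real.mul_self_sqrt (quasispectrum_nonneg_of_nonneg c hnn s hs)).symm

lemma CuntzBelow.iff_mem_closure {a b : B} :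
    CuntzBelow a b ↔ a ∈ closure (Set.range fun r : B => r * b * star r) := by
  rw [mem_closure_iff_seq_limit]
  constructor
  · rintro ⟨r, hr⟩
    exact ⟨_, fun n => ⟨r n, rfl⟩, hr⟩
  · rintro ⟨x, hx, hlim⟩
    choose r hr using hx
    exact ⟨r, by simpa only [hr] using hlim⟩

lemma CuntzBelow.isClosed_setOf (b : B) : IsClosed {a : B | CuntzBelow a b} := by
  simp only [CuntzBelow.iff_mem_closure]
  exact isClosed_closure

lemma cuntzBelow_conj (r b : B) : CuntzBelow (r * b * star r) b :=
  ⟨fun _ => r, tendsto_const_nhds⟩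

lemma CuntzBelow.trans {a b c : B} (hab : CuntzBelow a b) (hbc : CuntzBelow b c) :
    CuntzBelow a c := by
  obtain ⟨r, hr⟩ := hab
  obtain ⟨s, hs⟩ := hbc
  refine (CuntzBelow.isClosed_setOf c).mem_of_tendsto hr (.of_forall fun n => ?_)
  refine (CuntzBelow.isClosed_setOf c).mem_of_tendsto
    (f := fun m => r n * (s m * c * star (s m)) * star (r n)) (b := atTop)
    ((hs.const_mul (r n)).mul_const (star (r n))) (.of_forall fun m => ?_)
  simpa [mul_assoc] using cuntzBelow_conj (r n * s m) c

lemma CuntzBelow.eq_zero {a : B} (h : CuntzBelow a 0) : a = 0 := by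
  obtain ⟨r, hr⟩ := h
  simp only [mul_zero, zero_mul] at hr
  exact tendsto_nhds_unique hr tendsto_const_nhds

/-- Local approximate units of the form `t (x* x) t`, acting on `x` from the right. -/
lemma exists_tendsto_mul_conj (x : B) :
    ∃ t : ℕ → B, (∀ n, IsSelfAdjoint (t n)) ∧ (∀ n, Commute (t n) (star x * x)) ∧
      Tendsto (fun n => x * (t n * (star x * x) * t n)) atTop (𝓝 x) := by
  set h := star x * x with hh
  have hsa : IsSelfAdjoint h := IsSelfAdjoint.star_mul_self x
  have hpos := CStarNonneg.quasispectrum_nonneg (a := h) ⟨x, rfl⟩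
  let g : ℕ → ℝ → ℝ := fun n s => (n + 1) * √s / (1 + (n + 1) * |s|)
  have hg : ∀ n, Continuous (g n) := fun n =>
    Continuous.div (by fun_prop) (by fun_prop) fun s => by positivity
  have hg0 : ∀ n, g n 0 = 0 := fun n => by simp [g]
  refine ⟨fun n => cfcₙ (g n) h, fun n => cfcₙ_predicate _ h, fun n => ?_, ?_⟩
  · have := cfcₙ_commute_cfcₙ (g n) (fun s => s) h
    rwa [cfcₙ_id' ℝ h] at this
  have hk : ∀ n, cfcₙ (g n) h * h * cfcₙ (g n) h = cfcₙ (fun s => g n s * s * g n s) h := by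
    intro n
    have hgn := hg n
    rw [cfcₙ_mul _ _ h (by fun_prop) (by simp [hg0]) (by fun_prop) (hg0 n),
      cfcₙ_mul _ _ h (by fun_prop) (hg0 n) (by fun_prop) rfl, cfcₙ_id' ℝ h]
  simp only [hk]
  rw [tendsto_iff_norm_sub_tendsto_zero]
  have hbound : ∀ n : ℕ, ‖x * cfcₙ (fun s => g n s * s * g n s) h - x‖ ≤ √(2 / (n + 1)) := by
    intro n
    have hgn := hg n
    refine Real.le_sqrt_of_sq_le ?_
    set k : ℝ → ℝ := fun s => g n s * s * g n s with hkdef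
    have hkc : Continuous k := by fun_prop
    have hk0 : k 0 = 0 := by simp [k]
    have hksa : IsSelfAdjoint (cfcₙ k h) := cfcₙ_predicate _ h
    have heq : star (x * cfcₙ k h - x) * (x * cfcₙ k h - x)
        = cfcₙ (fun s => k s * s * k s - k s * s - s * k s + s) h := by
      rw [cfcₙ_add _ _ h (by fun_prop) (by simp [hk0]) (by fun_prop) rfl,
        cfcₙ_sub _ _ h (by fun_prop) (by simp [hk0]) (by fun_prop) (by simp [hk0]),
        cfcₙ_sub _ _ h (by fun_prop) (by simp [hk0]) (by fun_prop) (by simp [hk0]),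
        cfcₙ_mul _ _ h (by fun_prop) (by simp [hk0]) (by fun_prop) hk0,
        cfcₙ_mul _ _ h (by fun_prop) hk0 (by fun_prop) rfl,
        cfcₙ_mul _ _ h (by fun_prop) rfl (by fun_prop) hk0, cfcₙ_id' ℝ h,
        star_sub, star_mul, hksa.star_eq, hh]
      noncomm_ring
    rw [sq, ← CStarRing.norm_star_mul_self, heq]
    refine norm_cfcₙ_le fun s hs => ?_
    have hs0 := hpos s hs
    have hN : (0 : ℝ) < n + 1 := by positivity
    have hks : k s = ((n + 1) * s / (1 + (n + 1) * s)) ^ 2 := by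
      have := Real.mul_self_sqrt hs0
      simp only [k, g, abs_of_nonneg hs0]
      field_simp
      linear_combination s * this
    have hden : 0 < 1 + (n + 1) * s := by positivity
    set q : ℝ := (n + 1) * s / (1 + (n + 1) * s) with hq
    have hq0 : 0 ≤ q := by positivity
    have hq1 : q ≤ 1 := by
      rw [hq, div_le_one hden]
      linarith
    have hsq : s * (1 - q) ≤ 1 / (n + 1) := by
      have : 1 - q = 1 / (1 + (n + 1) * s) := by
        rw [hq]
        field_simp
        ring
      rw [this, mul_one_div, div_le_div_iff₀ hden hN]
      linarith
    have hval : k s * s * k s - k s * s - s * k s + s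
        = (s * (1 - q)) * ((1 + q) * (1 - q ^ 2)) := by
      rw [hks]
      ring
    have hs1 : 0 ≤ s * (1 - q) := mul_nonneg hs0 (by linarith)
    have hc0 : 0 ≤ (1 + q) * (1 - q ^ 2) := mul_nonneg (by linarith) (by nlinarith)
    have hc1 : (1 + q) * (1 - q ^ 2) ≤ 2 := by nlinarith [sq_nonneg q]
    rw [hval, Real.norm_of_nonneg (mul_nonneg hs1 hc0)]
    calc s * (1 - q) * ((1 + q) * (1 - q ^ 2)) ≤ 1 / (n + 1) * 2 := by gcongr
      _ = 2 / (n + 1) := by ring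
  refine squeeze_zero (fun n => norm_nonneg _) hbound ?_
  have h1 : Tendsto (fun n : ℕ => (2 : ℝ) / (n + 1)) atTop (𝓝 0) :=
    (tendsto_const_div_atTop_nhds_zero_nat 2).comp (tendsto_add_atTop_nat 1) |>.congr
      fun n => by simp
  have h2 := (Real.continuous_sqrt.tendsto 0).comp h1
  rw [Real.sqrt_zero] at h2
  exact h2

/-- `x x* ≼ x* x`. -/
lemma cuntzBelow_mul_star_self (x : B) : CuntzBelow (x * star x) (star x * x) := by
  obtain ⟨t, hsa, -, ht⟩ := exists_tendsto_mul_conj x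
  refine ⟨fun n => x * t n, ?_⟩
  refine (ht.mul_const (star x)).congr fun n => ?_
  rw [star_mul, (hsa n).star_eq]
  noncomm_ring

end CuntzComparison

section Cutdown

variable {B : Type*} [NonUnitalCStarAlgebra B]

lemma IsSelfAdjoint.cfcₙ_mul_id_mul_eq_zero {a y : B} (ha : IsSelfAdjoint a) {h : ℝ → ℝ}
    (hc : Continuous h) (h0 : h 0 = 0) (hy : a * y = 0) :
    cfcₙ (fun s => h s * s) a * y = 0 := by
  rw [cfcₙ_mul _ _ a (by fun_prop) h0 (by fun_prop) rfl, cfcₙ_id' ℝ a, mul_assoc, hy, mul_zero]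

lemma cutdown_eq_mul {ε : ℝ} (hε : 0 < ε) (s : ℝ) :
    max (s - ε) 0 = max (s - ε) 0 / max s ε * s := by
  rcases le_total s ε with h | h
  · simp [max_eq_right (sub_nonpos.2 h)]
  · have : 0 < s := hε.trans_le h
    rw [max_eq_left h]
    field_simp

lemma continuous_cutdown_div {ε : ℝ} (hε : 0 < ε) :
    Continuous fun s : ℝ => max (s - ε) 0 / max s ε :=
  Continuous.div (by fun_prop) (by fun_prop) fun s => (hε.trans_le (le_max_right s ε)).ne'

lemma cStarNonneg_cutdown {ε : ℝ} (hε : 0 < ε) (a : B) :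
    CStarNonneg (cfcₙ (fun s : ℝ => max (s - ε) 0) a) :=
  cStarNonneg_cfcₙ (by fun_prop) (by simp [hε.le]) fun s => le_max_right _ _

lemma IsSelfAdjoint.cutdown_mul_eq_zero {a y : B} (ha : IsSelfAdjoint a) {ε : ℝ} (hε : 0 < ε)
    (hy : a * y = 0) : cfcₙ (fun s : ℝ => max (s - ε) 0) a * y = 0 := by
  rw [show (fun s : ℝ => max (s - ε) 0) = fun s => max (s - ε) 0 / max s ε * s from
    funext (cutdown_eq_mul hε)]
  exact ha.cfcₙ_mul_id_mul_eq_zero (continuous_cutdown_div hε) (by simp [hε.le]) hy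

lemma IsSelfAdjoint.mul_eq_zero_comm {a b : B} (ha : IsSelfAdjoint a) (hb : IsSelfAdjoint b)
    (h : a * b = 0) : b * a = 0 := by
  simpa [ha.star_eq, hb.star_eq] using congrArg star h

lemma IsSelfAdjoint.cutdown_mul_cutdown_eq_zero {a b : B} (ha : IsSelfAdjoint a)
    (hb : IsSelfAdjoint b) {ε : ℝ} (hε : 0 < ε) (hab : a * b = 0) :
    cfcₙ (fun s : ℝ => max (s - ε) 0) a * cfcₙ (fun s : ℝ => max (s - ε) 0) b = 0 := by
  have hb' := (cStarNonneg_cutdown hε b).isSelfAdjoint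
  exact ha.cutdown_mul_eq_zero hε (hb'.mul_eq_zero_comm ha
    (hb.cutdown_mul_eq_zero hε (ha.mul_eq_zero_comm hb hab)))

lemma CStarNonneg.norm_cutdown_sub_le {a : B} (ha : CStarNonneg a) {ε : ℝ} (hε : 0 < ε) :
    ‖cfcₙ (fun s : ℝ => max (s - ε) 0) a - a‖ ≤ ε := by
  have hsa := ha.isSelfAdjoint
  conv_lhs => enter [1, 2]; rw [← cfcₙ_id' ℝ a]
  rw [← cfcₙ_sub _ _ a (by fun_prop) (by simp [hε.le]) (by fun_prop) rfl]
  refine norm_cfcₙ_le fun s hs => ?_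
  have := ha.quasispectrum_nonneg s hs
  rw [Real.norm_eq_abs, abs_le]
  rcases le_total s ε with h | h
  · rw [max_eq_right (by linarith)]
    constructor <;> linarith
  · rw [max_eq_left (by linarith)]
    constructor <;> linarith

lemma CStarNonneg.tendsto_cutdown {a : B} (ha : CStarNonneg a) :
    Tendsto (fun n : ℕ => cfcₙ (fun s : ℝ => max (s - 1 / ((n : ℝ) + 1)) 0) a) atTop (𝓝 a) := by
  rw [tendsto_iff_norm_sub_tendsto_zero]
  exact squeeze_zero (fun _ => norm_nonneg _)
    (fun n => ha.norm_cutdown_sub_le (by positivity)) tendsto_one_div_add_atTop_nhds_zero_nat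

end Cutdown

namespace IsCuntzSemigroupOf

variable {A : Type*} [NonUnitalCStarAlgebra A] {S : Type*} [CuSemigroup S]

lemma exists_orthogonal_representatives (hS : IsCuntzSemigroupOf A S) (x y : S) :
    ∃ a b : hS.stab, CStarNonneg a ∧ CStarNonneg b ∧ a * b = 0 ∧ hS.cls a = x ∧ hS.cls b = y := by
  obtain ⟨a, ha, rfl⟩ := hS.cls_surj x
  obtain ⟨b, hb, rfl⟩ := hS.cls_surj y
  exact hS.exists_orth a b ha hb

lemma splitsWayBelow (hS : IsCuntzSemigroupOf A S) : CuDiv.SplitsWayBelow S := by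
  intro g x y hg
  obtain ⟨a, b, ha, hb, hab, hax, hby⟩ := hS.exists_orthogonal_representatives x y
  obtain ⟨f, hf, hff, hfx⟩ := CuSemigroup.exists_waybelow_seq x
  obtain ⟨k, hk, hkk, hky⟩ := CuSemigroup.exists_waybelow_seq y
  obtain ⟨s, hs⟩ := CuSemigroup.exists_isLUB (fun n => f n + k n)
    fun m n hmn => add_le_add (hf hmn) (hk hmn)
  have hle : x + y ≤ s := by
    obtain ⟨c, hc, rfl⟩ := hS.cls_surj s
    rw [← hax, ← hby, ← hS.cls_add_orth a b ha hb hab, hS.cls_le_iff _ _ (ha.add hb) hc]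
    refine (CuntzBelow.isClosed_setOf c).mem_of_tendsto
      (ha.tendsto_cutdown.add hb.tendsto_cutdown) (.of_forall fun n => ?_)
    have hε : (0 : ℝ) < 1 / ((n : ℝ) + 1) := by positivity
    have hca := cStarNonneg_cutdown hε a
    have hcb := cStarNonneg_cutdown hε b
    change CuntzBelow _ _
    rw [← hS.cls_le_iff _ _ (hca.add hcb) hc, hS.cls_add_orth _ _ hca hcb
      (ha.isSelfAdjoint.cutdown_mul_cutdown_eq_zero hb.isSelfAdjoint hε hab)]
    obtain ⟨i, hi⟩ := (hS.waybelow_iff _ a ha).2 ⟨_, hε, le_rfl⟩ f hf x hfx hax.le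
    obtain ⟨j, hj⟩ := (hS.waybelow_iff _ b hb).2 ⟨_, hε, le_rfl⟩ k hk y hky hby.le
    calc _ ≤ f (max i j) + k (max i j) :=
          add_le_add (hi.trans (hf (le_max_left i j))) (hj.trans (hk (le_max_right i j)))
      _ ≤ _ := hs.1 ⟨max i j, rfl⟩
  obtain ⟨n, hn⟩ := hg _ (fun m n hmn => add_le_add (hf hmn) (hk hmn)) s hs hle
  exact ⟨f n, k n, (hff n).trans_le (hfx.1 ⟨n + 1, rfl⟩), (hkk n).trans_le (hky.1 ⟨n + 1, rfl⟩), hn⟩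

lemma infty_add_infty_le (hS : IsCuntzSemigroupOf A S) (y : S) :
    CuSemigroup.infty y + CuSemigroup.infty y ≤ CuSemigroup.infty y := by
  have hmono : Monotone fun n : ℕ => n • y :=
    fun m n hmn => nsmul_le_nsmul_left (CuSemigroup.zero_le' y) hmn
  have hlub := CuSemigroup.isLUB_infty y
  refine CuDiv.le_of_forall_wayBelow fun g hg => ?_
  obtain ⟨u, v, hu, hv, huv⟩ := hS.splitsWayBelow _ _ _ hg
  obtain ⟨i, hi⟩ := hu _ hmono _ hlub le_rfl
  obtain ⟨j, hj⟩ := hv _ hmono _ hlub le_rfl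
  calc g ≤ i • y + j • y := huv.trans (add_le_add hi hj)
    _ = (i + j) • y := (add_nsmul y i j).symm
    _ ≤ _ := hlub.1 ⟨i + j, rfl⟩

end IsCuntzSemigroupOf

section PrincipalIdeal

variable {B : Type*} [NonUnitalCStarAlgebra B]

/-- The closure of `B e B`; an ideal as soon as it is closed under addition. -/
def idealHull (e : B) : Set B := closure (Set.range fun r : B × B => r.1 * e * r.2)

lemma mul_mul_mem_idealHull (r e s : B) : r * e * s ∈ idealHull e :=
  subset_closure ⟨(r, s), rfl⟩

lemma isClosed_idealHull (e : B) : IsClosed (idealHull e) := isClosed_closure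

lemma mul_mem_idealHull_left {e x : B} (hx : x ∈ idealHull e) (a : B) : a * x ∈ idealHull e := by
  refine map_mem_closure (continuous_const_mul a) hx ?_
  rintro _ ⟨r, rfl⟩
  exact ⟨(a * r.1, r.2), by simp [mul_assoc]⟩

lemma mul_mem_idealHull_right {e x : B} (hx : x ∈ idealHull e) (a : B) : x * a ∈ idealHull e := by
  refine map_mem_closure (f := fun x => x * a) (continuous_mul_const a) hx ?_
  rintro _ ⟨r, rfl⟩
  exact ⟨(r.1, r.2 * a), by simp [mul_assoc]⟩

lemma star_mem_idealHull {e x : B} (he : IsSelfAdjoint e) (hx : x ∈ idealHull e) :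
    star x ∈ idealHull e := by
  refine map_mem_closure continuous_star hx ?_
  rintro _ ⟨r, rfl⟩
  exact ⟨(star r.2, star r.1), by simp [mul_assoc, he.star_eq]⟩

lemma smul_mem_idealHull {e x : B} (hx : x ∈ idealHull e) (c : ℂ) : c • x ∈ idealHull e := by
  refine map_mem_closure (continuous_const_smul c) hx ?_
  rintro _ ⟨r, rfl⟩
  exact ⟨(c • r.1, r.2), by simp [smul_mul_assoc]⟩

lemma zero_mem_idealHull (e : B) : (0 : B) ∈ idealHull e := by
  simpa using mul_mul_mem_idealHull 0 e 0

lemma idealHull_subset {e e' : B} (h : e ∈ idealHull e') : idealHull e ⊆ idealHull e' := by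
  refine closure_minimal ?_ (isClosed_idealHull e')
  rintro _ ⟨r, rfl⟩
  exact mul_mem_idealHull_right (mul_mem_idealHull_left h _) _

lemma CuntzBelow.mem_idealHull {a b : B} (h : CuntzBelow a b) : a ∈ idealHull b := by
  obtain ⟨r, hr⟩ := h
  exact (isClosed_idealHull b).mem_of_tendsto hr
    (.of_forall fun n => mul_mul_mem_idealHull _ _ _)

lemma mem_idealHull_of_star_mul_self {e x : B} (h : star x * x ∈ idealHull e) :
    x ∈ idealHull e := by
  obtain ⟨t, -, -, ht⟩ := exists_tendsto_mul_conj x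
  exact (isClosed_idealHull e).mem_of_tendsto ht (.of_forall fun n => mul_mem_idealHull_left
    (mul_mem_idealHull_right (mul_mem_idealHull_left h _) _) _)

lemma IsSelfAdjoint.mem_idealHull_cube {e : B} (he : IsSelfAdjoint e) :
    e ∈ idealHull (e * e * e) := by
  refine mem_idealHull_of_star_mul_self (mem_idealHull_of_star_mul_self
    (mem_idealHull_of_star_mul_self ?_))
  simpa only [star_mul, he.star_eq, mul_assoc] using
    mul_mul_mem_idealHull (e * e) (e * e * e) (e * e * e)

/-- If `e ⊕ e ≼ e` then the closure of `B e B` is closed under addition. -/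
lemma add_mem_idealHull {e e₁ e₂ x y : B} (h₁ : IsSelfAdjoint e₁) (h₂ : IsSelfAdjoint e₂)
    (horth : e₁ * e₂ = 0) (he₁ : CuntzBelow e e₁) (he₂ : CuntzBelow e e₂)
    (he : CuntzBelow (e₁ + e₂) e) (hx : x ∈ idealHull e) (hy : y ∈ idealHull e) :
    x + y ∈ idealHull e := by
  have horth' := h₁.mul_eq_zero_comm h₂ horth
  have hx' := idealHull_subset h₁.mem_idealHull_cube (idealHull_subset he₁.mem_idealHull hx)
  have hy' := idealHull_subset h₂.mem_idealHull_cube (idealHull_subset he₂.mem_idealHull hy)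
  refine idealHull_subset he.mem_idealHull (map_mem_closure₂ continuous_add hx' hy' ?_)
  rintro _ ⟨r, rfl⟩ _ ⟨s, rfl⟩
  refine ⟨(r.1 * e₁ + s.1 * e₂, e₁ * r.2 + e₂ * s.2), ?_⟩
  have h12 : ∀ z, e₁ * (e₂ * z) = 0 := fun z => by rw [← mul_assoc, horth, zero_mul]
  have h21 : ∀ z, e₂ * (e₁ * z) = 0 := fun z => by rw [← mul_assoc, horth', zero_mul]
  simp [mul_add, add_mul, mul_assoc, h12, h21]

/-- The closure of `B e B` as a closed ideal, when `e ⊕ e ≼ e`. -/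
def closedIdealHull (e : B) (he : IsSelfAdjoint e)
    (hadd : ∀ x ∈ idealHull e, ∀ y ∈ idealHull e, x + y ∈ idealHull e) :
    ClosedTwoSidedIdealC B where
  carrier :=
    { carrier := idealHull e
      add_mem' := fun hx hy => hadd _ hx _ hy
      zero_mem' := zero_mem_idealHull e
      mul_mem' := fun _ hy => mul_mem_idealHull_left hy _
      smul_mem' := fun c _ hx => smul_mem_idealHull hx c
      star_mem' := star_mem_idealHull he }
  isClosed := isClosed_idealHull e
  mul_mem_left := fun a _ hx => mul_mem_idealHull_left hx a
  mul_mem_right := fun a _ hx => mul_mem_idealHull_right hx a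

/-- The preimage of a closed ideal under a `*`-homomorphism. -/
def ClosedTwoSidedIdealC.comap {C : Type*} [NonUnitalCStarAlgebra C] (φ : C →⋆ₙₐ[ℂ] B)
    (I : ClosedTwoSidedIdealC B) : ClosedTwoSidedIdealC C where
  carrier := I.carrier.comap φ
  isClosed := I.isClosed.preimage (AddMonoidHomClass.continuous_of_bound φ 1 fun x => by
    simpa using NonUnitalStarAlgHom.norm_apply_le φ x)
  mul_mem_left := fun a x hx => by
    simpa [NonUnitalStarSubalgebra.mem_comap] using I.mul_mem_left (φ a) (φ x) hx
  mul_mem_right := fun a x hx => by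
    simpa [NonUnitalStarSubalgebra.mem_comap] using I.mul_mem_right (φ a) (φ x) hx

lemma CStarNonneg.cuntzBelow_of_mem_idealHull {a e : B} (ha : CStarNonneg a)
    (he : CStarNonneg e) (h : a ∈ idealHull e) : CuntzBelow a e := by
  obtain ⟨f, hf, rfl⟩ := ha.exists_sqrt
  have hmem : f ∈ idealHull e := mem_idealHull_of_star_mul_self (by rwa [hf.star_eq])
  have hclosed : IsClosed {z : B | CuntzBelow (z * star z) e} :=
    (CuntzBelow.isClosed_setOf e).preimage (f := fun z : B => z * star z) (by fun_prop)
  suffices f ∈ {z : B | CuntzBelow (z * star z) e} by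
    simpa only [Set.mem_ofPred_eq, hf.star_eq] using this
  refine closure_minimal ?_ hclosed hmem
  rintro _ ⟨⟨r, s⟩, rfl⟩
  obtain ⟨g, hg, rfl⟩ := he.exists_sqrt
  have h₁ := cuntzBelow_conj r ((g * g * s) * star (g * g * s))
  have h₂ := cuntzBelow_mul_star_self (g * g * s)
  have h₃ := cuntzBelow_conj (star s * g) (g * g)
  simp only [star_mul, hg.star_eq, star_star, mul_assoc, Set.mem_ofPred_eq] at h₁ h₂ h₃ ⊢
  exact h₁.trans (h₂.trans h₃)

end PrincipalIdeal

section Corner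

variable {A : Type*} [NonUnitalCStarAlgebra A]

/-- All entries outside the zeroth row vanish. -/
def IsRowMatrix {n : ℕ} (M : Matrix (Fin n) (Fin n) A) : Prop :=
  ∀ i j : Fin n, (i : ℕ) ≠ 0 → M i j = 0

lemma IsRowMatrix.matPad {n : ℕ} {M : Matrix (Fin n) (Fin n) A} (hM : IsRowMatrix M) :
    IsRowMatrix (matPad M) := by
  intro i j hi
  simp only [_root_.matPad, Matrix.of_apply]
  split_ifs with h
  · exact hM _ _ hi
  · rfl

/-- The `i`-th row of `X`, moved to the zeroth row. -/
def rowMatrix {n : ℕ} (X : Matrix (Fin n) (Fin n) A) (i : Fin n) : Matrix (Fin n) (Fin n) A :=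
  Matrix.of fun k j => if (k : ℕ) = 0 then X i j else 0

lemma isRowMatrix_rowMatrix {n : ℕ} (X : Matrix (Fin n) (Fin n) A) (i : Fin n) :
    IsRowMatrix (rowMatrix X i) := by
  intro k j hk
  simp [rowMatrix, hk]

lemma star_mul_self_eq_sum_rowMatrix {n : ℕ} (X : Matrix (Fin n) (Fin n) A) :
    star X * X = ∑ i, star (rowMatrix X i) * rowMatrix X i := by
  ext j l
  rw [Matrix.sum_apply]
  simp only [Matrix.mul_apply, Matrix.star_apply]
  refine Finset.sum_congr rfl fun i _ => ?_
  rw [Finset.sum_eq_single (⟨0, i.pos⟩ : Fin n)]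
  · simp [rowMatrix]
  · intro k _ hk
    have : (k : ℕ) ≠ 0 := fun h => hk (Fin.ext h)
    simp [rowMatrix, this]
  · simp

variable {S : Type*} [CuSemigroup S] (hS : IsCuntzSemigroupOf A S)

namespace IsCuntzSemigroupOf

/-- The canonical embedding of `A` into its stabilization. -/
def cornerEmb : A →⋆ₙₐ[ℂ] hS.stab where
  toFun a := hS.matEmb 1 (Matrix.of fun _ _ => a)
  map_smul' c a := by
    rw [← map_smul]
    rfl
  map_zero' := by
    rw [← map_zero (hS.matEmb 1)]
    rfl
  map_add' a b := by
    rw [← map_add]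
    rfl
  map_mul' a b := by
    rw [← map_mul]
    congr 1
    ext i j
    simp [Matrix.mul_apply]
  map_star' a := by
    rw [← map_star]
    congr 1

lemma cornerEmb_injective : Function.Injective hS.cornerEmb := by
  intro a b h
  exact congrFun (congrFun (hS.matEmb_injective 1 h) 0) 0

lemma matEmb_single (n : ℕ) (a : A) :
    hS.matEmb (n + 1) (Matrix.single 0 0 a) = hS.cornerEmb a := by
  induction n with
  | zero =>
    change hS.matEmb 1 _ = hS.matEmb 1 _
    refine congrArg (hS.matEmb 1) (Matrix.ext fun i j => ?_)
    obtain rfl : i = 0 := Subsingleton.elim (α := Fin 1) _ _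
    obtain rfl : j = 0 := Subsingleton.elim (α := Fin 1) _ _
    simp
  | succ n ih =>
    rw [← ih, ← hS.matEmb_compat (n + 1)]
    refine congrArg (hS.matEmb (n + 1 + 1)) (Matrix.ext fun i j => ?_)
    simp only [matPad, Matrix.of_apply, Matrix.single_apply, Fin.ext_iff, Fin.val_zero]
    split_ifs <;> first | rfl | omega

lemma exists_matEmb_eq_of_le {k N : ℕ} (h : k ≤ N) (X : Matrix (Fin k) (Fin k) A) :
    ∃ X' : Matrix (Fin N) (Fin N) A, hS.matEmb N X' = hS.matEmb k X ∧
      (IsRowMatrix X → IsRowMatrix X') := by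
  induction N, h using Nat.le_induction with
  | base => exact ⟨X, rfl, id⟩
  | succ N _ ih =>
    obtain ⟨Y, hY, hrow⟩ := ih
    exact ⟨matPad Y, by rw [hS.matEmb_compat, hY], fun hX => (hrow hX).matPad⟩

lemma matEmb_mem_range_cornerEmb {n : ℕ} (Y : Matrix (Fin n) (Fin n) A)
    (hY : ∀ i j : Fin n, (i : ℕ) ≠ 0 ∨ (j : ℕ) ≠ 0 → Y i j = 0) :
    hS.matEmb n Y ∈ Set.range hS.cornerEmb := by
  cases n with
  | zero => exact ⟨0, by rw [Subsingleton.elim Y 0, map_zero, map_zero]⟩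
  | succ n =>
    refine ⟨Y 0 0, ?_⟩
    rw [← hS.matEmb_single n]
    congr 1
    ext i j
    rw [Matrix.single_apply]
    split_ifs with h
    · obtain ⟨rfl, rfl⟩ := h
      rfl
    · refine (hY i j ?_).symm
      rw [not_and_or] at h
      exact h.imp (fun h hi => h (Fin.ext hi.symm)) fun h hj => h (Fin.ext hj.symm)

lemma matEmb_conj_mem_range {n k : ℕ} {M : Matrix (Fin n) (Fin n) A} (hM : IsRowMatrix M)
    (X : Matrix (Fin k) (Fin k) A) :
    hS.matEmb n M * hS.matEmb k X * star (hS.matEmb n M) ∈ Set.range hS.cornerEmb := by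
  obtain ⟨M', hM', hrow⟩ := hS.exists_matEmb_eq_of_le (show n ≤ max n k from le_max_left n k) M
  obtain ⟨X', hX', -⟩ := hS.exists_matEmb_eq_of_le (show k ≤ max n k from le_max_right n k) X
  rw [← hM', ← hX', ← map_star, ← map_mul, ← map_mul]
  refine hS.matEmb_mem_range_cornerEmb _ ?_
  rintro i j (h | h)
  · simp [Matrix.mul_apply, hrow hM i _ h]
  · simp [Matrix.mul_apply, hrow hM j _ h]

lemma matEmb_mul_star_mem_range {n : ℕ} {M : Matrix (Fin n) (Fin n) A} (hM : IsRowMatrix M) :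
    hS.matEmb n M * star (hS.matEmb n M) ∈ Set.range hS.cornerEmb := by
  rw [← map_star, ← map_mul]
  refine hS.matEmb_mem_range_cornerEmb _ ?_
  rintro i j (h | h)
  · simp [Matrix.mul_apply, hM i _ h]
  · simp [Matrix.mul_apply, hM j _ h]

lemma isClosed_range_cornerEmb : IsClosed (Set.range hS.cornerEmb) :=
  (NonUnitalStarAlgHom.isometry hS.cornerEmb
    hS.cornerEmb_injective).isClosedEmbedding.isClosed_range

lemma conj_mem_range {n : ℕ} {M : Matrix (Fin n) (Fin n) A} (hM : IsRowMatrix M) (e : hS.stab) :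
    hS.matEmb n M * e * star (hS.matEmb n M) ∈ Set.range hS.cornerEmb := by
  refine hS.isClosed_range_cornerEmb.closure_subset
    (map_mem_closure (f := fun e => hS.matEmb n M * e * star (hS.matEmb n M)) (by fun_prop)
      (hS.matEmb_dense e) ?_)
  intro x hx
  obtain ⟨k, X, rfl⟩ := Set.mem_iUnion.1 hx
  exact hS.matEmb_conj_mem_range hM X

lemma eq_zero_of_forall_row {f : hS.stab} (hf : IsSelfAdjoint f)
    (h : ∀ (n : ℕ) (M : Matrix (Fin n) (Fin n) A), IsRowMatrix M → hS.matEmb n M * f = 0) :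
    f = 0 := by
  have hmat : ∀ (n : ℕ) (X : Matrix (Fin n) (Fin n) A), hS.matEmb n X * f = 0 := by
    intro n X
    rw [← CStarRing.star_mul_self_eq_zero_iff, star_mul, mul_assoc,
      ← mul_assoc (star (hS.matEmb n X)),
      ← map_star, ← map_mul, star_mul_self_eq_sum_rowMatrix, map_sum, Finset.sum_mul,
      Finset.mul_sum]
    refine Finset.sum_eq_zero fun i _ => ?_
    rw [map_mul, mul_assoc, h n _ (isRowMatrix_rowMatrix X i), mul_zero, mul_zero]
  have hclosed : IsClosed {z : hS.stab | z * f = 0} :=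
    isClosed_eq (continuous_mul_const f) continuous_const
  have hall : f ∈ {z : hS.stab | z * f = 0} := by
    refine closure_minimal ?_ hclosed (hS.matEmb_dense f)
    intro x hx
    obtain ⟨k, X, rfl⟩ := Set.mem_iUnion.1 hx
    exact hmat k X
  rw [← CStarRing.star_mul_self_eq_zero_iff, hf.star_eq]
  exact hall

/-- Every nonzero positive element of the stabilization dominates one of the algebra. -/
lemma exists_corner_conj {e : hS.stab} (he : CStarNonneg e) (h0 : e ≠ 0) :
    ∃ (a : A) (m : hS.stab), a ≠ 0 ∧ hS.cornerEmb a = m * e * star m := by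
  obtain ⟨f, hf, rfl⟩ := he.exists_sqrt
  by_contra! hcon
  refine h0 ?_
  rw [hS.eq_zero_of_forall_row hf, mul_zero]
  intro n M hM
  obtain ⟨a, ha⟩ := hS.conj_mem_range hM (f * f)
  by_contra hne
  refine hcon a (hS.matEmb n M) ?_ ha
  rintro rfl
  rw [map_zero] at ha
  refine hne ?_
  rw [← CStarRing.mul_star_self_eq_zero_iff, ha, star_mul, hf.star_eq]
  simp only [mul_assoc]

lemma mem_idealHull_of_forall_cornerEmb {e : hS.stab} (he : IsSelfAdjoint e)
    (hadd : ∀ x ∈ idealHull e, ∀ y ∈ idealHull e, x + y ∈ idealHull e)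
    (h : ∀ a, hS.cornerEmb a ∈ idealHull e) (z : hS.stab) : z ∈ idealHull e := by
  have hrow : ∀ (n : ℕ) (M : Matrix (Fin n) (Fin n) A), IsRowMatrix M →
      hS.matEmb n M ∈ idealHull e := by
    intro n M hM
    have hmem : hS.matEmb n M * star (hS.matEmb n M) ∈ idealHull e := by
      obtain ⟨a, ha⟩ := hS.matEmb_mul_star_mem_range hM
      exact ha ▸ h a
    have := mem_idealHull_of_star_mul_self (x := star (hS.matEmb n M)) (by rwa [star_star])
    simpa using star_mem_idealHull he this
  refine closure_minimal ?_ (isClosed_idealHull e) (hS.matEmb_dense z)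
  intro x hx
  obtain ⟨k, X, rfl⟩ := Set.mem_iUnion.1 hx
  refine mem_idealHull_of_star_mul_self ?_
  rw [← map_star, ← map_mul, star_mul_self_eq_sum_rowMatrix, map_sum]
  refine Finset.sum_induction _ (· ∈ idealHull e) (fun x y hx hy => hadd x hx y hy)
    (zero_mem_idealHull e) fun i _ => ?_
  rw [map_mul]
  exact mul_mem_idealHull_left (hrow k _ (isRowMatrix_rowMatrix X i)) _

lemma everyNonzeroFull (hS : IsCuntzSemigroupOf A S) (hsimple : IsSimpleCStar A) :
    CuDiv.EveryNonzeroFull S := by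
  intro x y hy
  obtain ⟨e, he, hey⟩ := hS.cls_surj (CuSemigroup.infty y)
  have he0 : e ≠ 0 := by
    rintro rfl
    rw [hS.cls_zero] at hey
    refine hy (CuDiv.eq_zero_of_le_zero ?_)
    rw [hey]
    exact (CuSemigroup.isLUB_infty y).1 ⟨1, one_nsmul y⟩
  obtain ⟨e₁, e₂, he₁, he₂, horth, hc₁, hc₂⟩ := hS.exists_orth e e he he
  have hsum : CuntzBelow (e₁ + e₂) e := by
    rw [← hS.cls_le_iff _ _ (he₁.add he₂) he, hS.cls_add_orth _ _ he₁ he₂ horth, hc₁, hc₂, hey]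
    exact hS.infty_add_infty_le y
  have hadd : ∀ x ∈ idealHull e, ∀ y ∈ idealHull e, x + y ∈ idealHull e := fun x hx y hy =>
    add_mem_idealHull he₁.isSelfAdjoint he₂.isSelfAdjoint horth
      ((hS.cls_le_iff _ _ he he₁).1 hc₁.ge) ((hS.cls_le_iff _ _ he he₂).1 hc₂.ge) hsum hx hy
  let J := (closedIdealHull e he.isSelfAdjoint hadd).comap hS.cornerEmb
  have hJ : ∀ a, a ∈ (J.carrier : Set A) ↔ hS.cornerEmb a ∈ idealHull e := fun a => Iff.rfl
  obtain ⟨a, m, ha0, ha⟩ := hS.exists_corner_conj he he0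
  have hall : ∀ a, hS.cornerEmb a ∈ idealHull e := by
    rcases hsimple.2 J with h | h
    · refine absurd ?_ ha0
      have : a ∈ (J.carrier : Set A) := (hJ a).2 (ha ▸ mul_mul_mem_idealHull m e (star m))
      rwa [h] at this
    · intro b
      rw [← hJ, h]
      trivial
  obtain ⟨c, hc, rfl⟩ := hS.cls_surj x
  rw [← hey, hS.cls_le_iff _ _ hc he]
  exact hc.cuntzBelow_of_mem_idealHull he
    (hS.mem_idealHull_of_forall_cornerEmb he.isSelfAdjoint hadd hall c)

end IsCuntzSemigroupOf

end Corner

section MinimalProjection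

variable {B : Type*} [NonUnitalCStarAlgebra B]

/-- No two nonzero orthogonal positive elements have a sum below `a`. -/
def IsCuntzAtom (a : B) : Prop :=
  ∀ b c : B, CStarNonneg b → CStarNonneg c → b * c = 0 → CuntzBelow (b + c) a → b = 0 ∨ c = 0

lemma IsSelfAdjoint.eq_zero_of_mul_self {h : B} (hh : IsSelfAdjoint h) (h0 : h * h = 0) :
    h = 0 := by
  rw [← CStarRing.star_mul_self_eq_zero_iff, hh.star_eq, h0]

lemma IsSelfAdjoint.mem_idealHull_self {e : B} (he : IsSelfAdjoint e) : e ∈ idealHull e := by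
  refine mem_idealHull_of_star_mul_self (mem_idealHull_of_star_mul_self ?_)
  simpa only [star_mul, he.star_eq, mul_assoc] using mul_mul_mem_idealHull (e * e) e e

lemma IsSelfAdjoint.cfcₙ_ne_zero {h : B} (hh : IsSelfAdjoint h) {u : ℝ → ℝ} (hu : Continuous u)
    (hu0 : u 0 = 0) {μ : ℝ} (hμ : μ ∈ quasispectrum ℝ h) (huμ : u μ ≠ 0) : cfcₙ u h ≠ 0 := by
  intro h0
  rw [← cfcₙ_zero ℝ h, cfcₙ_eq_cfcₙ_iff_eqOn (ha := hh) (hf := by fun_prop) (hf0 := hu0)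
    (hg := by fun_prop) (hg0 := rfl)] at h0
  exact huμ (h0 hμ)

lemma IsCuntzAtom.quasispectrum_eq {a h : B} (hmin : IsCuntzAtom a) (ha : CStarNonneg a)
    (hh : IsSelfAdjoint h) (hmem : h ∈ idealHull a) {μ ν : ℝ} (hμ : μ ∈ quasispectrum ℝ h)
    (hν : ν ∈ quasispectrum ℝ h) (hμ0 : μ ≠ 0) (hν0 : ν ≠ 0) : μ = ν := by
  by_contra hne
  let δ : ℝ := |μ - ν| / 2
  have hδ : 0 < δ := half_pos (abs_pos.2 (sub_ne_zero.2 hne))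
  let w : ℝ → ℝ → ℝ := fun c s => max (δ - |s - c|) 0
  let u : ℝ → ℝ → ℝ := fun c s => s * (s * w c s)
  have hw : ∀ c, Continuous (w c) := fun c => by fun_prop
  have hu : ∀ c, Continuous (u c) := fun c => by fun_prop
  have hu0 : ∀ c, u c 0 = 0 := fun c => by simp [u]
  have hupos : ∀ c s, 0 ≤ u c s := fun c s => by
    rw [show u c s = s * s * w c s by simp only [u]; ring]
    exact mul_nonneg (mul_self_nonneg s) (le_max_right _ _)
  have hune : ∀ c, c ≠ 0 → u c c ≠ 0 := fun c hc => by
    simp [u, w, hc, max_eq_left hδ.le, hδ.ne']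
  have hww : ∀ s, w μ s * w ν s = 0 := fun s => by
    rcases le_total δ |s - μ| with h1 | h1
    · simp [w, max_eq_right (sub_nonpos.2 h1)]
    · have : δ ≤ |s - ν| := by
        have := abs_sub_le μ s ν
        rw [abs_sub_comm μ s] at this
        simp only [δ] at h1 ⊢
        linarith
      simp [w, max_eq_right (sub_nonpos.2 this)]
  have hzero : cfcₙ (u μ) h * cfcₙ (u ν) h = 0 := by
    rw [← cfcₙ_mul _ _ h (by fun_prop) (hu0 μ) (by fun_prop) (hu0 ν), ← cfcₙ_zero ℝ h]
    refine cfcₙ_congr fun s _ => ?_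
    change s * (s * w μ s) * (s * (s * w ν s)) = 0
    linear_combination s ^ 4 * hww s
  have hpos := fun c => cStarNonneg_cfcₙ (a := h) (hu c) (hu0 c) (hupos c)
  have hsum : cfcₙ (u μ) h + cfcₙ (u ν) h ∈ idealHull a := by
    have hwμ := hw μ
    have hwν := hw ν
    rw [← cfcₙ_add _ _ h (by fun_prop) (hu0 μ) (by fun_prop) (hu0 ν),
      show (fun s => u μ s + u ν s) = fun s => s * (s * (w μ s + w ν s)) from
        funext fun s => by simp only [u]; ring,
      cfcₙ_mul _ _ h (by fun_prop) rfl (by fun_prop) (by simp), cfcₙ_id' ℝ h]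
    exact mul_mem_idealHull_right hmem _
  rcases hmin _ _ (hpos μ) (hpos ν) hzero
    (((hpos μ).add (hpos ν)).cuntzBelow_of_mem_idealHull ha hsum) with h0 | h0
  · exact hh.cfcₙ_ne_zero (hu μ) (hu0 μ) hμ (hune μ hμ0) h0
  · exact hh.cfcₙ_ne_zero (hu ν) (hu0 ν) hν (hune ν hν0) h0

lemma IsCuntzAtom.exists_mul_self_eq {a h : B} (hmin : IsCuntzAtom a) (ha : CStarNonneg a)
    (hh : IsSelfAdjoint h) (hmem : h ∈ idealHull a) : ∃ ν : ℝ, h * h = ν • h := by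
  obtain ⟨ν, hν⟩ : ∃ ν : ℝ, ∀ s ∈ quasispectrum ℝ h, s * s = ν * s := by
    by_cases hex : ∃ μ ∈ quasispectrum ℝ h, μ ≠ 0
    · obtain ⟨μ, hμ, hμ0⟩ := hex
      refine ⟨μ, fun s hs => ?_⟩
      by_cases hs0 : s = 0
      · simp [hs0]
      · rw [hmin.quasispectrum_eq ha hh hmem hμ hs hμ0 hs0]
    · push Not at hex
      exact ⟨0, fun s hs => by simp [hex s hs]⟩
  refine ⟨ν, ?_⟩
  calc h * h = cfcₙ (fun s : ℝ => s * s) h := by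
        rw [cfcₙ_mul _ _ h (by fun_prop) rfl (by fun_prop) rfl, cfcₙ_id' ℝ h]
    _ = cfcₙ (fun s : ℝ => ν * s) h := cfcₙ_congr hν
    _ = ν • h := by rw [cfcₙ_const_mul _ _ h (by fun_prop) rfl, cfcₙ_id' ℝ h]

/-- A nonzero self-adjoint `h` in the ideal of an atom is a multiple of a projection. -/
lemma IsCuntzAtom.exists_projection {a h : B} (hmin : IsCuntzAtom a) (ha : CStarNonneg a)
    (hh : IsSelfAdjoint h) (hmem : h ∈ idealHull a) (h0 : h ≠ 0) :
    ∃ (ν : ℝ) (q : B), q ≠ 0 ∧ IsProjectionElem q ∧ h = ν • q ∧ ∃ t : ℝ, q = t • h := by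
  obtain ⟨ν, hν⟩ := hmin.exists_mul_self_eq ha hh hmem
  have hν0 : ν ≠ 0 := by
    rintro rfl
    exact h0 (hh.eq_zero_of_mul_self (by simpa using hν))
  refine ⟨ν, ν⁻¹ • h, smul_ne_zero (inv_ne_zero hν0) h0, ⟨?_, ?_⟩, ?_, ν⁻¹, rfl⟩
  · exact (IsSelfAdjoint.all _).smul hh
  · rw [smul_mul_smul_comm, hν, smul_smul]
    congr 1
    field_simp
  · rw [smul_smul, mul_inv_cancel₀ hν0, one_smul]

lemma IsProjectionElem.cStarNonneg {p : B} (hp : IsProjectionElem p) : CStarNonneg p :=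
  ⟨p, by rw [hp.1.star_eq, hp.2]⟩

lemma IsCuntzAtom.exists_minimal_projection {a : B} (hmin : IsCuntzAtom a) (ha : CStarNonneg a)
    (ha0 : a ≠ 0) :
    ∃ p : B, p ≠ 0 ∧ IsProjectionElem p ∧ ∀ x : B, ∃ c : ℂ, p * x * p = c • p := by
  obtain ⟨-, p, hp0, hp, -, t, hpa⟩ := hmin.exists_projection ha ha.isSelfAdjoint
    ha.isSelfAdjoint.mem_idealHull_self ha0
  have hpmem : p ∈ idealHull a := by
    rw [hpa, show t • a = (t : ℂ) • a from (Complex.coe_smul t a).symm]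
    exact smul_mem_idealHull ha.isSelfAdjoint.mem_idealHull_self _
  have hsa : ∀ x : B, IsSelfAdjoint x → ∃ c : ℝ, p * x * p = c • p := by
    intro x hx
    by_cases h0 : p * x * p = 0
    · exact ⟨0, by rw [h0, zero_smul]⟩
    have hxsa : IsSelfAdjoint (p * x * p) := by
      rw [IsSelfAdjoint, star_mul, star_mul, hp.1.star_eq, hx.star_eq, mul_assoc]
    obtain ⟨ν, q, hq0, hq, hxq, s, hqx⟩ := hmin.exists_projection ha hxsa
      (mul_mem_idealHull_right (mul_mem_idealHull_right hpmem x) p) h0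
    have hpq : p * q = q := by
      rw [hqx, mul_smul_comm, ← mul_assoc, ← mul_assoc, hp.2]
    have hqp : q * p = q := by
      rw [hqx, smul_mul_assoc, mul_assoc, hp.2]
    have hdiff : IsProjectionElem (p - q) :=
      ⟨hp.1.sub hq.1, by rw [mul_sub, sub_mul, sub_mul, hp.2, hpq, hqp, hq.2]; abel⟩
    have hcases := hmin q (p - q) hq.cStarNonneg hdiff.cStarNonneg
      (by rw [mul_sub, hqp, hq.2, sub_self])
      (by rw [add_sub_cancel]; exact hp.cStarNonneg.cuntzBelow_of_mem_idealHull ha hpmem)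
    have hpq' := sub_eq_zero.1 (hcases.resolve_left hq0)
    exact ⟨ν, by rw [hxq, hpq']⟩
  refine ⟨p, hp0, hp, fun x => ?_⟩
  obtain ⟨c, hc⟩ := hsa _ (realPart x).2
  obtain ⟨d, hd⟩ := hsa _ (imaginaryPart x).2
  refine ⟨(c : ℂ) + Complex.I * d, ?_⟩
  conv_lhs => rw [← realPart_add_I_smul_imaginaryPart x]
  rw [mul_add, add_mul, mul_smul_comm, smul_mul_assoc, hc, hd, add_smul, mul_smul,
    Complex.coe_smul, Complex.coe_smul]

end MinimalProjection

lemma IsCuntzSemigroupOf.exists_cuntzAtom {A : Type*} [NonUnitalCStarAlgebra A] {S : Type*}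
    [CuSemigroup S] (hS : IsCuntzSemigroupOf A S) (hsimple : IsSimpleCStar A)
    (hat : ¬ CuDiv.Atomless S) : ∃ a : A, a ≠ 0 ∧ CStarNonneg a ∧ IsCuntzAtom a := by
  rw [CuDiv.Atomless] at hat
  push Not at hat
  obtain ⟨y, hy, hno⟩ := hat
  obtain ⟨e, he, rfl⟩ := hS.cls_surj y
  have he0 : e ≠ 0 := by
    rintro rfl
    exact hy hS.cls_zero
  obtain ⟨a, m, ha0, ha⟩ := hS.exists_corner_conj he he0
  have hmap : ∀ b : A, CStarNonneg b → CStarNonneg (hS.cornerEmb b) := by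
    rintro _ ⟨b, rfl⟩
    exact ⟨hS.cornerEmb b, by rw [map_mul, map_star]⟩
  have hpos : CStarNonneg (star a * a) := ⟨a, rfl⟩
  have hbelow : CuntzBelow (hS.cornerEmb (star a * a)) e := by
    refine (hmap _ hpos).cuntzBelow_of_mem_idealHull he ?_
    rw [map_mul, ha]
    exact mul_mem_idealHull_left (mul_mul_mem_idealHull _ _ _) _
  refine ⟨star a * a, fun h => ha0 (CStarRing.star_mul_self_eq_zero_iff a |>.1 h), hpos, ?_⟩
  rintro b c hb hc hbc ⟨r, hr⟩
  have hcont : Continuous hS.cornerEmb :=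
    (NonUnitalStarAlgHom.isometry hS.cornerEmb hS.cornerEmb_injective).continuous
  have hsum : hS.cls (hS.cornerEmb b) + hS.cls (hS.cornerEmb c) ≤ hS.cls e := by
    rw [← hS.cls_add_orth _ _ (hmap b hb) (hmap c hc) (by rw [← map_mul, hbc, map_zero]),
      hS.cls_le_iff _ _ ((hmap b hb).add (hmap c hc)) he, ← map_add]
    refine CuntzBelow.trans ⟨fun n => hS.cornerEmb (r n), ?_⟩ hbelow
    exact ((hcont.tendsto _).comp hr).congr fun n => by simp [map_star]
  have hne : ∀ b : A, CStarNonneg b → b ≠ 0 → hS.cls (hS.cornerEmb b) ≠ 0 := by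
    intro b hb hb0 h
    rw [← hS.cls_zero] at h
    have := ((hS.cls_le_iff _ _ (hmap b hb) cStarNonneg_zero).1 h.le).eq_zero
    exact hb0 (hS.cornerEmb_injective (this.trans (map_zero _).symm))
  by_contra! hcon
  obtain ⟨d, hd0, hdb, hdc⟩ := CuDiv.exists_common_lower_bound (hS.everyNonzeroFull hsimple)
    (hne b hb hcon.1) (hne c hc hcon.2)
  exact hno d hd0 ((add_le_add hdb hdc).trans hsum)

section CompactOperators

variable {H : Type*} [NormedAddCommGroup H] [InnerProductSpace ℂ H]

open InnerProductSpace in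
/-- Compact operators on a Hilbert space are limits of sums of rank one operators. -/
lemma IsCompactOperator.exists_norm_sub_sum_rankOne_le [CompleteSpace H] {T : H →L[ℂ] H}
    (hT : IsCompactOperator T) {ε : ℝ} (hε : 0 < ε) :
    ∃ (n : ℕ) (u v : Fin n → H), ‖T - ∑ i, rankOne ℂ (u i) (v i)‖ ≤ ε := by
  have hcpt := IsCompactOperator.isCompact_closure_image_closedBall (f := (T : H →ₗ[ℂ] H)) hT 1
  obtain ⟨t, -, htfin, htcov⟩ := exists_finite_cover_balls_of_isCompact_closure hcpt hε
  let U : Submodule ℂ H := Submodule.span ℂ t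
  have : FiniteDimensional ℂ U := FiniteDimensional.span_of_finite ℂ htfin
  let b := stdOrthonormalBasis ℂ U
  refine ⟨_, fun i => (b i : H), fun i => ContinuousLinearMap.adjoint T (b i : H), ?_⟩
  have hsum : ∑ i, rankOne ℂ (b i : H) (ContinuousLinearMap.adjoint T (b i : H))
      = U.starProjection ∘L T := by
    rw [b.starProjection_eq_sum_rankOne]
    ext x
    simp [ContinuousLinearMap.adjoint_inner_left]
  rw [hsum]
  have hball : ∀ x : H, ‖x‖ ≤ 1 → ‖T x - U.starProjection (T x)‖ ≤ ε := by
    intro x hx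
    have hmem : T x ∈ ⋃ y ∈ t, Metric.ball y ε := htcov ⟨x, by simpa using hx, rfl⟩
    simp only [Set.mem_iUnion, Metric.mem_ball, dist_eq_norm] at hmem
    obtain ⟨y, hy, hxy⟩ := hmem
    rw [Submodule.starProjection_minimal]
    exact (ciInf_le ⟨0, by rintro _ ⟨z, rfl⟩; positivity⟩
      (⟨y, Submodule.subset_span hy⟩ : U)).trans hxy.le
  refine ContinuousLinearMap.opNorm_le_bound _ hε.le fun x => ?_
  by_cases hx : x = 0
  · simp [hx]
  have hx' : ‖x‖ ≠ 0 := norm_ne_zero_iff.2 hx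
  have h1 := hball (((‖x‖⁻¹ : ℝ) : ℂ) • x) (by simp [norm_smul, hx'])
  rw [map_smul, map_smul, ← smul_sub, norm_smul, Complex.norm_real, norm_inv, norm_norm,
    inv_mul_le_iff₀ (norm_pos_iff.2 hx), mul_comm] at h1
  exact h1

lemma isCompactOperator_of_rank_one {T : H →L[ℂ] H} {u v : H}
    (h : ∀ w, T w = inner ℂ v w • u) : IsCompactOperator T := by
  have : T = ContinuousLinearMap.toSpanSingleton ℂ u ∘L innerSL ℂ v := by
    ext w
    simp [h]
  rw [this]
  have hv : IsCompactOperator (innerSL ℂ v : H →L[ℂ] ℂ) :=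
    isCompactOperator_of_locallyCompactSpace_dom (innerSL ℂ v : H →L[ℂ] ℂ)
  exact hv.clm_comp (ContinuousLinearMap.toSpanSingleton ℂ u)

end CompactOperators

section Elementary

/-- A closed subset of a C*-algebra which is a two-sided ideal, as a closed ideal. -/
def ClosedTwoSidedIdealC.ofSubmodule {A : Type*} [NonUnitalCStarAlgebra A] (I : Submodule ℂ A)
    (hI : IsClosed (I : Set A)) (hl : ∀ a : A, ∀ x ∈ I, a * x ∈ I)
    (hr : ∀ a : A, ∀ x ∈ I, x * a ∈ I) : ClosedTwoSidedIdealC A where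
  carrier :=
    { carrier := I
      add_mem' := I.add_mem
      zero_mem' := I.zero_mem
      mul_mem' := fun _ hy => hl _ _ hy
      smul_mem' := fun c _ hx => I.smul_mem c hx
      star_mem' := fun {x} hx => by
        obtain ⟨t, -, -, ht⟩ := exists_tendsto_mul_conj (star x)
        refine hI.mem_of_tendsto ht (.of_forall fun n => ?_)
        rw [star_star]
        exact hl _ _ (hr _ _ (hl _ _ (hr _ _ hx))) }
  isClosed := hI
  mul_mem_left := hl
  mul_mem_right := hr

lemma IsSimpleCStar.eq_top_of_mem {A : Type*} [NonUnitalCStarAlgebra A] (hA : IsSimpleCStar A)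
    {I : Submodule ℂ A} (hI : IsClosed (I : Set A)) (hl : ∀ a : A, ∀ x ∈ I, a * x ∈ I)
    (hr : ∀ a : A, ∀ x ∈ I, x * a ∈ I) {p : A} (hp0 : p ≠ 0) (hp : p ∈ I) (a : A) : a ∈ I := by
  rcases hA.2 (.ofSubmodule I hI hl hr) with h | h
  · exact absurd (h.subset (show p ∈ (I : Set A) from hp)) hp0
  · exact h.superset (Set.mem_univ a)

variable {A : Type} [NonUnitalCStarAlgebra A]

/-- A simple C*-algebra represented with all rank one operators in the image is elementary. -/
lemma IsSimpleCStar.isElementaryCStar_of_rank_one (hA : IsSimpleCStar A) {H : Type}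
    [NormedAddCommGroup H] [InnerProductSpace ℂ H] [CompleteSpace H] [Nontrivial H]
    (ψ : A →⋆ₙₐ[ℂ] (H →L[ℂ] H))
    (hrank : ∀ u v : H, ∃ a, ∀ w, ψ a w = inner ℂ v w • u) : IsElementaryCStar A := by
  obtain ⟨u, hu⟩ := exists_ne (0 : H)
  obtain ⟨p, hp⟩ := hrank u u
  have hψp : ψ p ≠ 0 := fun h => by
    have := hp u
    rw [h, zero_apply, eq_comm, smul_eq_zero, inner_self_eq_zero] at this
    exact hu (this.elim id id)
  have hp0 : p ≠ 0 := by
    rintro rfl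
    exact hψp (map_zero ψ)
  have hcont : Continuous ψ := AddMonoidHomClass.continuous_of_bound ψ 1 fun x => by
    simpa using NonUnitalStarAlgHom.norm_apply_le ψ x
  have hinj : Function.Injective ψ := by
    rw [injective_iff_map_eq_zero]
    intro a ha
    by_contra ha0
    let I : Submodule ℂ A :=
      { carrier := {x | ψ x = 0}
        add_mem' := fun {x y} (hx : ψ x = 0) (hy : ψ y = 0) => by
          change ψ (x + y) = 0
          rw [map_add, hx, hy, add_zero]
        zero_mem' := map_zero ψ
        smul_mem' := fun c x (hx : ψ x = 0) => by
          change ψ (c • x) = 0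
          rw [map_smul, hx, smul_zero] }
    exact hψp (hA.eq_top_of_mem (I := I) (isClosed_eq hcont continuous_const)
      (fun b x (hx : ψ x = 0) => by
        change ψ (b * x) = 0
        rw [map_mul, hx, mul_zero])
      (fun b x (hx : ψ x = 0) => by
        change ψ (x * b) = 0
        rw [map_mul, hx, zero_mul]) ha0 ha p)
  have hcompact : ∀ a, IsCompactOperator (ψ a) := by
    let I : Submodule ℂ A :=
      { carrier := {x | IsCompactOperator (ψ x)}
        add_mem' := fun {x y} (hx : IsCompactOperator (ψ x)) (hy : IsCompactOperator (ψ y)) => by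
          change IsCompactOperator (ψ (x + y))
          rw [map_add]
          exact hx.add hy
        zero_mem' := by
          change IsCompactOperator (ψ 0)
          rw [map_zero]
          exact isCompactOperator_zero
        smul_mem' := fun c x (hx : IsCompactOperator (ψ x)) => by
          change IsCompactOperator (ψ (c • x))
          rw [map_smul]
          exact hx.smul c }
    exact hA.eq_top_of_mem (I := I) (isClosed_setOfPred_isCompactOperator.preimage hcont)
      (fun b x (hx : IsCompactOperator (ψ x)) => by
        change IsCompactOperator (ψ (b * x))
        rw [map_mul]
        exact hx.clm_comp (ψ b))
      (fun b x (hx : IsCompactOperator (ψ x)) => by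
        change IsCompactOperator (ψ (x * b))
        rw [map_mul]
        exact hx.comp_clm (ψ b)) hp0 (isCompactOperator_of_rank_one hp)
  refine ⟨H, inferInstance, inferInstance, inferInstance, ψ, hinj, ?_⟩
  refine Set.Subset.antisymm (by rintro _ ⟨a, rfl⟩; exact hcompact a) fun T hT => ?_
  have hclosed : IsClosed (Set.range ψ) :=
    (NonUnitalStarAlgHom.isometry ψ hinj).isClosedEmbedding.isClosed_range
  refine hclosed.closure_subset (Metric.mem_closure_iff.2 fun ε hε => ?_)
  obtain ⟨n, u, v, huv⟩ := IsCompactOperator.exists_norm_sub_sum_rankOne_le hT (half_pos hε)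
  choose a ha using fun i => hrank (u i) (v i)
  refine ⟨_, ⟨∑ i, a i, rfl⟩, ?_⟩
  have : ψ (∑ i, a i) = ∑ i, InnerProductSpace.rankOne ℂ (u i) (v i) := by
    rw [map_sum]
    refine Finset.sum_congr rfl fun i _ => ?_
    ext w
    simp [ha]
  rw [dist_eq_norm, this]
  exact huv.trans_lt (half_lt_self hε)

end Elementary

section MinimalProjectionRepresentation

open ComplexConjugate

/-- A minimal projection `p` carries a linear functional `φ` with `p x p = φ(x) p`, which is
compatible with the norm on the left ideal `A p`. -/
lemma IsProjectionElem.exists_functional {A : Type*} [NonUnitalCStarAlgebra A] {p : A}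
    (hp : IsProjectionElem p) (hp0 : p ≠ 0) (hmin : ∀ x, ∃ c : ℂ, p * x * p = c • p) :
    ∃ φ : A →ₗ[ℂ] ℂ, (∀ x, p * x * p = φ x • p) ∧ (∀ x, φ (star x) = conj (φ x)) ∧
      ∀ x, x * p = x → ‖x‖ ^ 2 = (φ (star x * x)).re := by
  choose φ hφ using hmin
  have hinj : Function.Injective fun c : ℂ => c • p := smul_left_injective ℂ hp0
  have hstar : ∀ x, φ (star x) = conj (φ x) := fun x => hinj <| by
    change φ (star x) • p = star (φ x) • p
    have := congrArg star (hφ x)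
    rwa [star_mul, star_mul, star_smul, hp.1.star_eq, ← mul_assoc, hφ] at this
  refine ⟨⟨⟨φ, fun x y => hinj ?_⟩, fun c x => hinj ?_⟩, hφ, hstar, fun x hx => ?_⟩
  · simp only [add_smul, ← hφ, mul_add, add_mul]
  · simp only [RingHom.id_apply, smul_assoc, ← hφ, mul_smul_comm, smul_mul_assoc]
  · change _ = (φ (star x * x)).re
    have hxx : star x * x = φ (star x * x) • p := by
      rw [← hφ]
      nth_rw 1 [← hx]
      rw [star_mul, hp.1.star_eq, mul_assoc, mul_assoc, mul_assoc, hx]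
    have hreal : ((φ (star x * x)).re : ℂ) = φ (star x * x) := by
      rw [← Complex.conj_eq_iff_re, ← hstar, star_mul, star_star]
    have hnp : ‖p‖ = 1 := by
      have h1 : ‖p‖ * ‖p‖ = ‖p‖ := by
        rw [← CStarRing.norm_star_mul_self, hp.1.star_eq, hp.2]
      exact mul_right_cancel₀ (norm_ne_zero_iff.2 hp0) (h1.trans (one_mul _).symm)
    set c := (φ (star x * x)).re with hc
    rw [← hreal] at hxx
    have hc0 : 0 ≤ c := by
      by_contra! hneg
      let := CStarAlgebra.spectralOrder A
      have := CStarAlgebra.spectralOrderedRing A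
      have hy : 0 ≤ star (((√(-c) : ℝ) : ℂ) • p) * (((√(-c) : ℝ) : ℂ) • p) :=
        star_mul_self_nonneg _
      have hyc : star (((√(-c) : ℝ) : ℂ) • p) * (((√(-c) : ℝ) : ℂ) • p) = -(star x * x) := by
        rw [hxx, star_smul, smul_mul_smul_comm, hp.1.star_eq, hp.2, ← neg_smul, RCLike.star_def,
          Complex.conj_ofReal, ← Complex.ofReal_mul, Real.mul_self_sqrt (by linarith)]
        simp
      have h0 : star x * x = 0 :=
        le_antisymm (by rw [hyc] at hy; exact neg_nonneg.1 hy) (star_mul_self_nonneg x)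
      rw [h0, eq_comm, smul_eq_zero, or_iff_left hp0, Complex.ofReal_eq_zero] at hxx
      exact hneg.ne hxx
    rw [sq, ← CStarRing.norm_star_mul_self, hxx, norm_smul, hnp, mul_one, Complex.norm_real,
      Real.norm_of_nonneg hc0]

/-- A simple C*-algebra with a minimal projection is elementary. -/
lemma IsSimpleCStar.isElementaryCStar_of_minimal_projection {A : Type} [NonUnitalCStarAlgebra A]
    (hA : IsSimpleCStar A) {p : A} (hp : IsProjectionElem p) (hp0 : p ≠ 0)
    (hmin : ∀ x, ∃ c : ℂ, p * x * p = c • p) : IsElementaryCStar A := by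
  obtain ⟨φ, hφ, hstar, hnorm⟩ := hp.exists_functional hp0 hmin
  let H : Submodule ℂ A := LinearMap.eqLocus (LinearMap.mulRight ℂ p) LinearMap.id
  have hH : ∀ x : H, (x : A) * p = x := fun x => x.2
  have hclosed : IsClosed (H : Set A) :=
    isClosed_eq (continuous_id.mul continuous_const) continuous_id
  have : CompleteSpace H := hclosed.completeSpace_coe
  have : Nontrivial H := ⟨⟨p, hp.2⟩, 0, fun h => hp0 (congrArg Subtype.val h)⟩
  let : InnerProductSpace ℂ H :=
    { (inferInstance : NormedSpace ℂ H) with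
      inner := fun x y => φ (star (x : A) * y)
      norm_sq_eq_re_inner := fun x => hnorm x (hH x)
      conj_inner_symm := fun x y => by rw [← hstar, star_mul, star_star]
      add_left := fun x y z => by simp [add_mul]
      smul_left := fun x y c => by simp [smul_mul_assoc] }
  have hinner : ∀ x y : H, inner ℂ x y = φ (star (x : A) * y) := fun _ _ => rfl
  let L : A → H →L[ℂ] H := fun a => LinearMap.mkContinuous
    ((LinearMap.mulLeft ℂ a).restrict (p := H) (q := H)
      fun x hx => show a * x * p = a * x by rw [mul_assoc, hH ⟨x, hx⟩]) ‖a‖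
    fun x => norm_mul_le a (x : A)
  have hL : ∀ a (x : H), (L a x : A) = a * x := fun _ _ => rfl
  let ψ : A →⋆ₙₐ[ℂ] (H →L[ℂ] H) :=
    { toFun := L
      map_smul' := fun c a => by ext x; simp [hL, smul_mul_assoc]
      map_zero' := by ext x; simp [hL]
      map_add' := fun a b => by ext x; simp [hL, add_mul]
      map_mul' := fun a b => by ext x; simp [hL, mul_assoc]
      map_star' := fun a => by
        rw [ContinuousLinearMap.star_eq_adjoint, ContinuousLinearMap.eq_adjoint_iff]
        intro x y
        simp [hinner, hL, mul_assoc] }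
  refine hA.isElementaryCStar_of_rank_one ψ fun u v => ⟨u * star (v : A), fun w => ?_⟩
  ext
  change (u : A) * star (v : A) * w = φ (star (v : A) * w) • (u : A)
  have hvw : star (v : A) * w = φ (star (v : A) * w) • p := by
    rw [← hφ]
    nth_rw 1 [← hH v]
    rw [star_mul, hp.1.star_eq, mul_assoc, mul_assoc, mul_assoc, hH]
  rw [mul_assoc, hvw, mul_smul_comm, hH, ← hvw]

end MinimalProjectionRepresentation

theorem IsCuntzSemigroupOf.atomless {A : Type} [NonUnitalCStarAlgebra A] {S : Type}
    [CuSemigroup S] (hS : IsCuntzSemigroupOf A S) (hsimple : IsSimpleCStar A)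
    (hnonelem : ¬ IsElementaryCStar A) : CuDiv.Atomless S := by
  by_contra hat
  obtain ⟨a, ha0, ha, hatom⟩ := hS.exists_cuntzAtom hsimple hat
  obtain ⟨p, hp0, hp, hmin⟩ := hatom.exists_minimal_projection ha ha0
  exact hnonelem (hsimple.isElementaryCStar_of_minimal_projection hp hp0 hmin)

/-- Corollary 4.13.  For a simple, non-elementary C*-algebra whose
Cuntz semigroup has covering dimension zero and is weakly cancellative, there is a
uniform bound `wdiv₂(x) ≤ n` over all `x ∈ Cu(A)`. -/
theorem bounded_wdiv_of_dimZero
    (A : Type) [NonUnitalCStarAlgebra A] (S : Type) [CuSemigroup S]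
    (hS : IsCuntzSemigroupOf A S)
    (hsimple : IsSimpleCStar A) (hnonelem : ¬ IsElementaryCStar A)
    (hdim0 : CuDiv.CoveringDimZero S) (hwc : CuDiv.WeaklyCancellative S) :
    ∃ n : ℕ, ∀ x : S, CuDiv.wdiv 2 x ≤ (n : ℕ∞) := by
  have hat := hS.atomless hsimple hnonelem
  have hdiv := CuDiv.isWeaklyDivisible_two_four hS.splitsWayBelow (hS.everyNonzeroFull hsimple)
    hat hdim0 hwc
  exact ⟨4, fun x => CuDiv.wdiv_le_of_isWeaklyDivisible (by norm_num) (hdiv x)⟩
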